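/- For every constant ε > 0 and every integer Δ ≥ 3, if p = p(n) is a sequence of edge probabilities satisfying p(n) · n^{1/(Δ−1)} / (log n)^5 → ∞ as n → ∞, then the probability that the binomial random graph G(n, p(n)) is H(⌊(1−ε)n⌋, Δ)-universal tends to 1 as n → ∞. -/

import Mathlib

open Finset Filter Real
open scoped Classical
/-- Number of edges of a graph. -/
noncomputable def edgeCount {α : Type*} (G : SimpleGraph α) : ℕ := Nat.card G.edgeSet

/-- The probability that the binomial random graph `G(n,p)` satisfies the property `P`. -/
noncomputable def gnpProb (n : ℕ) (p : ℝ) (P : SimpleGraph (Fin n) → Prop) : ℝ :=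
  ∑ G : SimpleGraph (Fin n),
    if P G then p ^ edgeCount G * (1 - p) ^ (n.choose 2 - edgeCount G) else 0

/-- `G` contains a (not necessarily induced) copy of `H`. -/
def containsCopy {α β : Type*} (G : SimpleGraph α) (H : SimpleGraph β) : Prop :=
  ∃ f : β → α, Function.Injective f ∧ ∀ a b, H.Adj a b → G.Adj (f a) (f b)

/-- `H` has maximum degree at most `Δ`. -/
def maxDegLE {β : Type*} (H : SimpleGraph β) (Δ : ℕ) : Prop :=
  ∀ v, Nat.card (H.neighborSet v) ≤ Δ

/-- `G` is `H(N, Δ)`-universal: it contains every graph on at most `N` vertices with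
maximum degree at most `Δ`. -/
def IsUniversal {n : ℕ} (G : SimpleGraph (Fin n)) (N Δ : ℕ) : Prop :=
  ∀ m : ℕ, m ≤ N → ∀ H : SimpleGraph (Fin m), maxDegLE H Δ → containsCopy G H


noncomputable def wt {ι : Type*} [Fintype ι] (q : ι → ℝ) (A : Finset ι) : ℝ :=
  ∏ e, if e ∈ A then q e else 1 - q e

lemma wt_nonneg {ι : Type*} [Fintype ι] (q : ι → ℝ) (hq : ∀ e, 0 ≤ q e ∧ q e ≤ 1)
    (A : Finset ι) : 0 ≤ wt q A := by
  unfold wt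
  refine Finset.prod_nonneg fun e _ => ?_
  split_ifs
  · exact (hq e).1
  · linarith [(hq e).2]

lemma sum_wt {ι : Type*} [Fintype ι] (q : ι → ℝ) : ∑ A, wt q A = 1 := by
  have h := Finset.prod_add q (fun e => 1 - q e) (Finset.univ : Finset ι)
  simp only [add_sub_cancel, Finset.prod_const_one, Finset.powerset_univ] at h
  rw [h]
  refine Finset.sum_congr rfl fun A _ => ?_
  unfold wt
  rw [Finset.prod_ite]
  congr 1
  · congr 1; ext; simp
  · congr 1; ext; simp

lemma sum_split {ι : Type*} [Fintype ι] (e : ι) (g : Finset ι → ℝ) :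
    ∑ A, g A = ∑ A ∈ Finset.univ.filter (fun A : Finset ι => e ∉ A), (g A + g (insert e A)) := by
  rw [Finset.sum_add_distrib, ← Finset.sum_filter_add_sum_filter_not Finset.univ (fun A : Finset ι => e ∉ A)]
  congr 1
  symm
  refine Finset.sum_bij (fun A _ => insert e A) ?_ ?_ ?_ ?_
  · intro A _; simp
  · intro A hA B hB h
    simp only [Finset.mem_filter, Finset.mem_univ, true_and] at hA hB
    rw [← Finset.erase_insert hA, h, Finset.erase_insert hB]
  · intro B hB
    simp only [Finset.mem_filter, Finset.mem_univ, true_and, not_not] at hB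
    exact ⟨B.erase e, by simp, Finset.insert_erase hB⟩
  · intros; rfl

lemma wt_split {ι : Type*} [Fintype ι] (q : ι → ℝ) (e : ι) (A : Finset ι) (h : e ∉ A) :
    ∃ c, wt q A = (1 - q e) * c ∧ wt q (insert e A) = q e * c := by
  refine ⟨∏ x ∈ Finset.univ.erase e, if x ∈ A then q x else 1 - q x, ?_, ?_⟩
  · unfold wt
    rw [← Finset.mul_prod_erase _ _ (Finset.mem_univ e)]; simp [h]
  · unfold wt
    rw [← Finset.mul_prod_erase _ _ (Finset.mem_univ e)]
    simp only [Finset.mem_insert_self, if_true]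
    congr 1
    refine Finset.prod_congr rfl fun x hx => ?_
    have : x ≠ e := (Finset.mem_erase.1 hx).1
    simp [this]

lemma ex_insert {ι : Type*} [Fintype ι] (q : ι → ℝ) (e : ι) (f : Finset ι → ℝ) :
    ∑ A, wt q A * (if e ∈ A then f A else 0) = q e * ∑ A, wt q A * f (insert e A) := by
  rw [sum_split e, sum_split e (fun A => wt q A * f (insert e A)), Finset.mul_sum]
  refine Finset.sum_congr rfl fun A hA => ?_
  simp only [Finset.mem_filter, Finset.mem_univ, true_and] at hA
  obtain ⟨c, h1, h2⟩ := wt_split q e A hA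
  simp only [hA, if_false, Finset.mem_insert_self, if_true, Finset.insert_idem, h1, h2]
  ring

lemma ex_union {ι : Type*} [Fintype ι] (q : ι → ℝ) (S : Finset ι) :
    ∀ f : Finset ι → ℝ, ∑ A, wt q A * (if S ⊆ A then f A else 0) =
      (∏ e ∈ S, q e) * ∑ A, wt q A * f (A ∪ S) := by
  induction S using Finset.induction_on with
  | empty => intro f; simp
  | insert e S he ih =>
    intro f
    have h1 : ∀ A, (if insert e S ⊆ A then f A else 0) =
        if e ∈ A then (if S ⊆ A then f A else 0) else 0 := by
      intro A
      simp only [Finset.insert_subset_iff]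
      split_ifs <;> simp_all
    simp only [h1]
    rw [ex_insert]
    have h2 : ∀ A, (if S ⊆ insert e A then f (insert e A) else 0) =
        if S ⊆ A then f (insert e A) else 0 := by
      intro A
      simp only [Finset.subset_insert_iff_of_notMem he]
    simp only [h2]
    rw [ih (fun A => f (insert e A)), Finset.prod_insert he, mul_assoc]
    simp only [Finset.union_insert]

lemma prob_subset {ι : Type*} [Fintype ι] (q : ι → ℝ) (S : Finset ι) :
    ∑ A, wt q A * (if S ⊆ A then 1 else 0) = ∏ e ∈ S, q e := by
  rw [ex_union q S (fun _ => 1)]; simp [sum_wt]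

lemma harris {ι : Type*} [Fintype ι] (q : ι → ℝ) (hq : ∀ e, 0 ≤ q e ∧ q e ≤ 1)
    (f g : Finset ι → ℝ) (hf0 : ∀ A, 0 ≤ f A) (hg0 : ∀ A, 0 ≤ g A)
    (hf : Antitone f) (hg : Antitone g) :
    (∑ A, wt q A * f A) * (∑ A, wt q A * g A) ≤ ∑ A, wt q A * (f A * g A) := by
  have key := fkg (α := (Finset ι)ᵒᵈ) (β := ℝ) (μ := fun A => wt q (OrderDual.ofDual A))
    (f := fun A => f (OrderDual.ofDual A)) (g := fun A => g (OrderDual.ofDual A))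
    (fun A => wt_nonneg q hq _) (fun A => hf0 _) (fun A => hg0 _)
    (fun a b h => hf h) (fun a b h => hg h) ?_
  · have e1 : ∑ a : (Finset ι)ᵒᵈ, wt q (OrderDual.ofDual a) = 1 := sum_wt q
    rw [e1, one_mul] at key
    exact key
  · intro a b
    change wt q (OrderDual.ofDual a) * wt q (OrderDual.ofDual b) ≤
      wt q (OrderDual.ofDual a ⊔ OrderDual.ofDual b) * wt q (OrderDual.ofDual a ⊓ OrderDual.ofDual b)
    generalize OrderDual.ofDual a = a
    generalize OrderDual.ofDual b = b
    unfold wt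
    rw [← Finset.prod_mul_distrib, ← Finset.prod_mul_distrib]
    apply le_of_eq
    refine Finset.prod_congr rfl fun e _ => ?_
    by_cases h1 : e ∈ a <;> by_cases h2 : e ∈ b <;> simp [h1, h2, mul_comm]

/-- Janson inequality, weighted form. -/
theorem janson {ι I : Type*} [Fintype ι] [Fintype I] (q : ι → ℝ)
    (hq : ∀ e, 0 ≤ q e ∧ q e ≤ 1) (S : I → Finset ι) (hS : ∀ i, ∀ e ∈ S i, 0 < q e)
    (D : ℝ) (hD : 0 < D)
    (hDD : ∑ i, ∑ j, (if (S i ∩ S j).Nonempty then (∏ e ∈ S i ∩ S j, q e)⁻¹ else 0) ≤ D) :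
    ∑ A, wt q A * (if ∀ i, ¬ S i ⊆ A then 1 else 0) ≤
      Real.exp (-((Fintype.card I : ℝ) ^ 2 / (2 * D))) := by
  set a : I → ℝ := fun i => (∏ e ∈ S i, q e)⁻¹ with ha
  have hpos : ∀ i, 0 < ∏ e ∈ S i, q e := fun i => Finset.prod_pos (hS i)
  have ha0 : ∀ i, 0 < a i := fun i => inv_pos.2 (hpos i)
  set X : Finset ι → ℝ := fun A => ∑ i, a i * (if S i ⊆ A then 1 else 0) with hX
  have hXnn : ∀ A, 0 ≤ X A := fun A => Finset.sum_nonneg fun i _ =>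
    mul_nonneg (ha0 i).le (by split_ifs <;> norm_num)
  have hmono : ∀ (J : Finset I), Monotone (fun A => ∑ i ∈ J, a i * (if S i ⊆ A then (1:ℝ) else 0)) := by
    intro J A B hAB
    refine Finset.sum_le_sum fun i _ => mul_le_mul_of_nonneg_left ?_ (ha0 i).le
    split_ifs with h1 h2
    · exact le_rfl
    · exact absurd (h1.trans hAB) h2
    · norm_num
    · exact le_rfl
  set ψ : ℝ → ℝ := fun s => ∑ A, wt q A * Real.exp (-s * X A) with hψ
  set N : ℝ := (Fintype.card I : ℝ) with hN
  have hψpos : ∀ s, 0 ≤ ψ s := fun s => Finset.sum_nonneg fun A _ =>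
    mul_nonneg (wt_nonneg q hq A) (Real.exp_pos _).le
  have hderiv : ∀ s, HasDerivAt ψ (∑ A, wt q A * (Real.exp (-s * X A) * (-X A))) s := by
    intro s
    refine HasDerivAt.fun_sum fun A _ => ?_
    refine HasDerivAt.const_mul _ ?_
    have h1 : HasDerivAt (fun s : ℝ => -s * X A) (-X A) s := by
      simpa using ((hasDerivAt_id s).neg.mul_const (X A))
    exact h1.exp
  have hmain : ∀ s, 0 ≤ s → ψ s * (N - s * D) ≤ ∑ A, wt q A * (Real.exp (-s * X A) * X A) := by
    intro s hs
    have e1 : ∑ A, wt q A * (Real.exp (-s * X A) * X A) =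
        ∑ i, ∑ A, wt q A * Real.exp (-s * X (A ∪ S i)) := by
      have : ∀ A, wt q A * (Real.exp (-s * X A) * X A) =
          ∑ i, a i * (wt q A * (if S i ⊆ A then Real.exp (-s * X A) else 0)) := by
        intro A
        have hXA : X A = ∑ i, a i * (if S i ⊆ A then 1 else 0) := rfl
        generalize Real.exp (-s * X A) = E
        rw [hXA]
        simp only [Finset.mul_sum]
        refine Finset.sum_congr rfl fun i _ => ?_
        split_ifs <;> ring
      simp only [this]
      rw [Finset.sum_comm]
      refine Finset.sum_congr rfl fun i _ => ?_
      rw [← Finset.mul_sum, ex_union q (S i) (fun A => Real.exp (-s * X A)), ← mul_assoc, ha]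
      simp only
      rw [inv_mul_cancel₀ (hpos i).ne', one_mul]
    rw [e1]
    set Di : I → ℝ := fun i => ∑ j, (if (S i ∩ S j).Nonempty then (∏ e ∈ S i ∩ S j, q e)⁻¹ else 0) with hDi
    have hi : ∀ i, ψ s * (1 - s * Di i) ≤ ∑ A, wt q A * Real.exp (-s * X (A ∪ S i)) := by
      intro i
      set Ji := Finset.univ.filter (fun j => (S i ∩ S j).Nonempty) with hJi
      set Y : Finset ι → ℝ := fun A => ∑ j ∈ Ji, a j * (if S j ⊆ A ∪ S i then 1 else 0) with hY
      have hYnn : ∀ A, 0 ≤ Y A := fun A => Finset.sum_nonneg fun j _ =>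
        mul_nonneg (ha0 j).le (by split_ifs <;> norm_num)
      have hXle : ∀ A, X (A ∪ S i) ≤ Y A + X A := by
        intro A
        have : X (A ∪ S i) = Y A + ∑ j ∈ Finset.univ.filter (fun j => ¬ (S i ∩ S j).Nonempty),
            a j * (if S j ⊆ A ∪ S i then 1 else 0) := by
          rw [hX, hY, hJi]; simp only
          rw [Finset.sum_filter_add_sum_filter_not]
        rw [this]
        gcongr
        calc _ ≤ ∑ j ∈ Finset.univ.filter (fun j => ¬ (S i ∩ S j).Nonempty),
            a j * (if S j ⊆ A then 1 else 0) := by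
              refine Finset.sum_le_sum fun j hj => mul_le_mul_of_nonneg_left ?_ (ha0 j).le
              simp only [Finset.mem_filter, Finset.mem_univ, true_and,
                Finset.not_nonempty_iff_eq_empty] at hj
              by_cases h : S j ⊆ A ∪ S i
              · have : S j ⊆ A := by
                  intro e he
                  rcases Finset.mem_union.1 (h he) with h' | h'
                  · exact h'
                  · exfalso
                    have : e ∈ S i ∩ S j := Finset.mem_inter.2 ⟨h', he⟩
                    rw [hj] at this; simp at this
                simp [h, this]
              · simp only [h, if_false]; split_ifs <;> norm_num
          _ ≤ X A := by
              rw [hX]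
              refine Finset.sum_le_sum_of_subset_of_nonneg (Finset.filter_subset _ _) ?_
              intro j _ _
              exact mul_nonneg (ha0 j).le (by split_ifs <;> norm_num)
      have hYmono : Monotone Y := fun A B hAB => hmono Ji (Finset.union_subset_union_left hAB)
      have hXmono : Monotone X := hmono Finset.univ
      have hanti : ∀ Z : Finset ι → ℝ, Monotone Z → Antitone (fun A => Real.exp (-s * Z A)) := by
        intro Z hZ A B hAB
        apply Real.exp_le_exp.2
        have := mul_le_mul_of_nonneg_left (hZ hAB) hs
        linarith
      have har := harris q hq (fun A => Real.exp (-s * Y A)) (fun A => Real.exp (-s * X A))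
        (fun A => (Real.exp_pos _).le) (fun A => (Real.exp_pos _).le) (hanti Y hYmono) (hanti X hXmono)
      have hEY : ∑ A, wt q A * Y A = Di i := by
        rw [hY, hDi]
        simp only [Finset.mul_sum]
        rw [Finset.sum_comm, hJi, Finset.sum_filter]
        refine Finset.sum_congr rfl fun j _ => ?_
        split_ifs with hne
        · have h1 : ∀ A, wt q A * (a j * (if S j ⊆ A ∪ S i then 1 else 0)) =
              a j * (wt q A * (if S j \ S i ⊆ A then 1 else 0)) := by
            intro A
            have : S j ⊆ A ∪ S i ↔ S j \ S i ⊆ A := by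
              rw [Finset.union_comm]; exact sdiff_le_iff.symm
            simp only [this]; ring
          simp only [h1]
          rw [← Finset.mul_sum, prob_subset, ha]
          simp only
          have h2 : ∏ e ∈ S j, q e = (∏ e ∈ S j \ S i, q e) * ∏ e ∈ S i ∩ S j, q e := by
            rw [Finset.inter_comm, mul_comm, Finset.prod_inter_mul_prod_sdiff]
          have h3 : (∏ e ∈ S j \ S i, q e) ≠ 0 := by
            intro h0; rw [h0, zero_mul] at h2; exact (hpos j).ne' h2
          rw [h2, mul_inv, mul_comm, ← mul_assoc, mul_inv_cancel₀ h3, one_mul]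
        · rfl
      have hEe : 1 - s * Di i ≤ ∑ A, wt q A * Real.exp (-s * Y A) := by
        have : 1 - s * Di i = ∑ A, wt q A * (1 - s * Y A) := by
          simp only [mul_sub, mul_one, Finset.sum_sub_distrib, sum_wt]
          rw [← hEY, Finset.mul_sum]
          congr 1
          refine Finset.sum_congr rfl fun A _ => by ring
        rw [this]
        refine Finset.sum_le_sum fun A _ => mul_le_mul_of_nonneg_left ?_ (wt_nonneg q hq A)
        have := Real.add_one_le_exp (-s * Y A)
        linarith
      calc ψ s * (1 - s * Di i) ≤ ψ s * ∑ A, wt q A * Real.exp (-s * Y A) :=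
            mul_le_mul_of_nonneg_left hEe (hψpos s)
        _ = (∑ A, wt q A * Real.exp (-s * Y A)) * ψ s := mul_comm _ _
        _ ≤ ∑ A, wt q A * (Real.exp (-s * Y A) * Real.exp (-s * X A)) := har
        _ ≤ _ := by
            refine Finset.sum_le_sum fun A _ => mul_le_mul_of_nonneg_left ?_ (wt_nonneg q hq A)
            rw [← Real.exp_add]
            apply Real.exp_le_exp.2
            have := mul_le_mul_of_nonneg_left (hXle A) hs
            linarith
    calc ψ s * (N - s * D) ≤ ψ s * (N - s * ∑ i, Di i) := by
          refine mul_le_mul_of_nonneg_left ?_ (hψpos s)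
          have := mul_le_mul_of_nonneg_left hDD hs
          linarith
      _ = ∑ i, ψ s * (1 - s * Di i) := by
          rw [← Finset.mul_sum, Finset.sum_sub_distrib, ← Finset.mul_sum]
          simp [hN]
      _ ≤ _ := Finset.sum_le_sum fun i _ => hi i
  set g : ℝ → ℝ := fun s => ψ s * Real.exp (N * s - s ^ 2 * D / 2) with hg
  have hgd : ∀ s, HasDerivAt g ((∑ A, wt q A * (Real.exp (-s * X A) * (-X A))) *
      Real.exp (N * s - s ^ 2 * D / 2) + ψ s * (Real.exp (N * s - s ^ 2 * D / 2) * (N - s * D))) s := by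
    intro s
    refine (hderiv s).mul ?_
    have h1 : HasDerivAt (fun s : ℝ => N * s - s ^ 2 * D / 2) (N - s * D) s := by
      have h2 : HasDerivAt (fun s : ℝ => N * s - s ^ 2 * D / 2)
          (N * 1 - ((2 : ℕ) : ℝ) * s ^ (2 - 1) * 1 * D / 2) s :=
        ((hasDerivAt_id s).const_mul N).sub ((((hasDerivAt_id s).pow 2).mul_const D).div_const 2)
      have h3 : N - s * D = N * 1 - ((2 : ℕ) : ℝ) * s ^ (2 - 1) * 1 * D / 2 := by
        norm_num; ring
      rw [h3]; exact h2
    exact h1.exp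
  have hanti : AntitoneOn g (Set.Ici 0) := by
    refine antitoneOn_of_deriv_nonpos (convex_Ici 0) ?_ ?_ ?_
    · exact fun s _ => (hgd s).continuousAt.continuousWithinAt
    · exact fun s _ => (hgd s).differentiableAt.differentiableWithinAt
    · intro s hs
      rw [interior_Ici] at hs
      rw [(hgd s).deriv]
      have h1 := hmain s (le_of_lt hs)
      have h2 : ∑ A, wt q A * (Real.exp (-s * X A) * (-X A)) =
          - ∑ A, wt q A * (Real.exp (-s * X A) * X A) := by
        rw [← Finset.sum_neg_distrib]
        exact Finset.sum_congr rfl fun A _ => by ring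
      rw [h2]
      have h3 := Real.exp_pos (N * s - s ^ 2 * D / 2)
      nlinarith
  have hN0 : 0 ≤ N := by positivity
  have hs0 : 0 ≤ N / D := by positivity
  have h1 := hanti (Set.mem_Ici.2 le_rfl) (Set.mem_Ici.2 hs0) hs0
  have hg0 : g 0 = 1 := by simp [hg, hψ, sum_wt]
  rw [hg0] at h1
  have h2 : ψ (N / D) ≤ Real.exp (-(N ^ 2 / (2 * D))) := by
    have h3 : N * (N / D) - (N / D) ^ 2 * D / 2 = N ^ 2 / (2 * D) := by
      field_simp; ring
    rw [hg] at h1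
    simp only [h3] at h1
    rw [Real.exp_neg, ← one_div, le_div_iff₀ (Real.exp_pos _)]
    exact h1
  refine le_trans (Finset.sum_le_sum fun A _ => mul_le_mul_of_nonneg_left ?_ (wt_nonneg q hq A)) h2
  split_ifs with h
  · have : X A = 0 := by
      rw [hX]
      refine Finset.sum_eq_zero fun i _ => by simp [h i]
    simp [this]
  · exact (Real.exp_pos _).le


/-- Edges required by a template `(N, I)` placed at `x`. -/
noncomputable def tEdges {V : Type*} {K : ℕ} (N : Fin K → Finset V) (I : SimpleGraph (Fin K))
    (x : Fin K → V) : Finset (Sym2 V) :=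
  (Finset.univ.biUnion fun i => (N i).image fun y => s(x i, y)) ∪
    (Finset.univ.filter fun ij : Fin K × Fin K => I.Adj ij.1 ij.2).image
      fun ij => s(x ij.1, x ij.2)

lemma mem_tEdges {V : Type*} {K : ℕ} (N : Fin K → Finset V) (I : SimpleGraph (Fin K))
    (x : Fin K → V) (e : Sym2 V) : e ∈ tEdges N I x ↔
      (∃ i, ∃ y ∈ N i, e = s(x i, y)) ∨ (∃ i j, I.Adj i j ∧ e = s(x i, x j)) := by
  unfold tEdges
  simp only [Finset.mem_union, Finset.mem_biUnion, Finset.mem_univ, true_and, Finset.mem_image,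
    Finset.mem_filter, Prod.exists, eq_comm]

/-- the degree in a pattern -/
noncomputable def dg {K : ℕ} (I : SimpleGraph (Fin K)) (i : Fin K) : ℕ :=
  (Finset.univ.filter fun j => I.Adj i j).card

/-- restriction of a graph to a set of vertices -/
def restr {W : Type*} (I : SimpleGraph W) (F : Finset W) : SimpleGraph W where
  Adj i j := I.Adj i j ∧ i ∈ F ∧ j ∈ F
  symm := ⟨fun i j h => ⟨h.1.symm, h.2.2, h.2.1⟩⟩
  loopless := ⟨fun i h => I.loopless.irrefl i h.1⟩

lemma two_card_restr {W : Type*} [Fintype W] (I : SimpleGraph W) (F : Finset W) :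
    2 * (restr I F).edgeFinset.card = ∑ i ∈ F, (F.filter fun j => I.Adj i j).card := by
  rw [← SimpleGraph.sum_degrees_eq_twice_card_edges]
  rw [← Finset.sum_subset (Finset.subset_univ F)]
  · refine Finset.sum_congr rfl fun i hi => ?_
    rw [← SimpleGraph.card_neighborFinset_eq_degree]
    congr 1
    ext j
    rw [SimpleGraph.mem_neighborFinset]; simp only [Finset.mem_filter]
    exact ⟨fun h => ⟨h.2.2, h.1⟩, fun h => ⟨h.2, hi, h.1⟩⟩
  · intro i _ hi
    rw [← SimpleGraph.card_neighborFinset_eq_degree, Finset.card_eq_zero]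
    ext j
    simp only [SimpleGraph.mem_neighborFinset, Finset.notMem_empty, iff_false]
    exact fun h => hi h.2.1

lemma inter_sub {V : Type*} {K : ℕ} (U : Fin K → Finset V)
    (hU : ∀ i j, i ≠ j → Disjoint (U i) (U j))
    (N N' : Fin K → Finset V) (I I' : SimpleGraph (Fin K))
    (hN : ∀ i j, Disjoint (N i) (U j)) (hN' : ∀ i j, Disjoint (N' i) (U j))
    (x x' : Fin K → V) (hx : ∀ i, x i ∈ U i) (hx' : ∀ i, x' i ∈ U i) :
    tEdges N I x ∩ tEdges N' I' x' ⊆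
      ((Finset.univ.filter fun i => x i = x' i).biUnion fun i => (N i ∩ N' i).image fun y => s(x i, y))
      ∪ ((restr I (Finset.univ.filter fun i => x i = x' i)).edgeFinset).image (Sym2.map x) := by
  have hUU : ∀ i j v, v ∈ U i → v ∈ U j → i = j := by
    intro i j v h1 h2
    by_contra h
    exact (Finset.disjoint_left.1 (hU i j h) h1 h2)
  have hNU : ∀ i j v, v ∈ N i → v ∈ U j → False := fun i j v h1 h2 =>
    Finset.disjoint_left.1 (hN i j) h1 h2
  have hNU' : ∀ i j v, v ∈ N' i → v ∈ U j → False := fun i j v h1 h2 =>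
    Finset.disjoint_left.1 (hN' i j) h1 h2
  intro e he
  rw [Finset.mem_inter, mem_tEdges, mem_tEdges] at he
  obtain ⟨h1, h2⟩ := he
  rw [Finset.mem_union]
  rcases h1 with ⟨i, y, hy, rfl⟩ | ⟨i, j, hij, rfl⟩
  · left
    rcases h2 with ⟨k, z, hz, h⟩ | ⟨k, l, hkl, h⟩
    · rw [Sym2.eq_iff] at h
      rcases h with ⟨h3, h4⟩ | ⟨h3, h4⟩
      · have : i = k := hUU i k _ (hx i) (h3 ▸ hx' k)
        subst this; subst h4
        simp only [Finset.mem_biUnion, Finset.mem_filter, Finset.mem_univ, true_and, Finset.mem_image,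
          Finset.mem_inter]
        exact ⟨i, h3, y, ⟨hy, hz⟩, rfl⟩
      · exact (hNU' k i _ hz (h3 ▸ hx i)).elim
    · rw [Sym2.eq_iff] at h
      rcases h with ⟨h3, h4⟩ | ⟨h3, h4⟩
      · exact (hNU i l _ hy (h4 ▸ hx' l)).elim
      · exact (hNU i k _ hy (h4 ▸ hx' k)).elim
  · right
    rcases h2 with ⟨k, z, hz, h⟩ | ⟨k, l, hkl, h⟩
    · rw [Sym2.eq_iff] at h
      rcases h with ⟨h3, h4⟩ | ⟨h3, h4⟩
      · exact (hNU' k j _ hz (h4 ▸ hx j)).elim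
      · exact (hNU' k i _ hz (h3 ▸ hx i)).elim
    · have hF : x i = x' i ∧ x j = x' j := by
        rw [Sym2.eq_iff] at h
        rcases h with ⟨h3, h4⟩ | ⟨h3, h4⟩
        · have e1 : i = k := hUU i k _ (hx i) (h3 ▸ hx' k)
          have e2 : j = l := hUU j l _ (hx j) (h4 ▸ hx' l)
          subst e1; subst e2; exact ⟨h3, h4⟩
        · have e1 : i = l := hUU i l _ (hx i) (h3 ▸ hx' l)
          have e2 : j = k := hUU j k _ (hx j) (h4 ▸ hx' k)
          subst e1; subst e2; exact ⟨h3, h4⟩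
      rw [Finset.mem_image]
      refine ⟨s(i, j), ?_, by simp⟩
      rw [SimpleGraph.mem_edgeFinset, SimpleGraph.mem_edgeSet]
      exact ⟨hij, by simp [hF.1], by simp [hF.2]⟩

lemma inter_card {V : Type*} {K : ℕ} (U : Fin K → Finset V)
    (hU : ∀ i j, i ≠ j → Disjoint (U i) (U j))
    (N N' : Fin K → Finset V) (I I' : SimpleGraph (Fin K))
    (hN : ∀ i j, Disjoint (N i) (U j)) (hN' : ∀ i j, Disjoint (N' i) (U j))
    (x x' : Fin K → V) (hx : ∀ i, x i ∈ U i) (hx' : ∀ i, x' i ∈ U i) :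
    2 * (tEdges N I x ∩ tEdges N' I' x').card ≤
      ∑ i ∈ (Finset.univ.filter fun i => x i = x' i), (2 * (N i ∩ N' i).card + dg I i) := by
  set F := Finset.univ.filter fun i => x i = x' i with hF
  have h1 := Finset.card_le_card (inter_sub U hU N N' I I' hN hN' x x' hx hx')
  have h2 : (tEdges N I x ∩ tEdges N' I' x').card ≤ (F.biUnion fun i => (N i ∩ N' i).image fun y => s(x i, y)).card + (((restr I F).edgeFinset).image (Sym2.map x)).card :=
    h1.trans (Finset.card_union_le _ _)
  have h3 : (F.biUnion fun i => (N i ∩ N' i).image fun y => s(x i, y)).card ≤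
      ∑ i ∈ F, (N i ∩ N' i).card :=
    Finset.card_biUnion_le.trans (Finset.sum_le_sum fun i _ => Finset.card_image_le)
  have h4 : (((restr I F).edgeFinset).image (Sym2.map x)).card ≤ (restr I F).edgeFinset.card :=
    Finset.card_image_le
  have h5 : 2 * (restr I F).edgeFinset.card ≤ ∑ i ∈ F, dg I i := by
    rw [two_card_restr]
    refine Finset.sum_le_sum fun i _ => ?_
    unfold dg
    exact Finset.card_le_card (Finset.filter_subset_filter _ (Finset.subset_univ _))
  rw [Finset.sum_add_distrib, ← Finset.mul_sum]
  omega

lemma pairsum {V : Type*} {K u : ℕ} (hu : 1 ≤ u) (U : Fin K → Finset V) (hUc : ∀ i, (U i).card = u)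
    (x : Fin K → V) (Q : ℝ) (hQ : 0 < Q) (T : Finset (Fin K)) :
    ∑ x' ∈ Fintype.piFinset U, (if T ⊆ (Finset.univ.filter fun i => x i = x' i) then
      Q ^ (Finset.univ.filter fun i => x i = x' i).card else 0) ≤ (Q / u) ^ T.card * (u + Q) ^ K := by
  have hu' : (1:ℝ) ≤ u := by exact_mod_cast hu
  have h1 : ∀ x' : Fin K → V, (if T ⊆ (Finset.univ.filter fun i => x i = x' i) then
      Q ^ (Finset.univ.filter fun i => x i = x' i).card else 0) =
      ∏ i, (if x i = x' i then Q else if i ∈ T then 0 else 1) := by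
    intro x'
    split_ifs with h
    · rw [Finset.card_eq_sum_ones, Finset.sum_filter, ← Finset.prod_pow_eq_pow_sum]
      refine Finset.prod_congr rfl fun i _ => ?_
      by_cases hi : x i = x' i
      · simp [hi]
      · have : i ∉ T := fun hT => hi (by simpa using h hT)
        simp [hi, this]
    · rw [Finset.not_subset] at h
      obtain ⟨i, hi, hi'⟩ := h
      symm
      refine Finset.prod_eq_zero (Finset.mem_univ i) ?_
      have : x i ≠ x' i := by simpa using hi'
      simp [this, hi]
  simp only [h1]
  rw [← Finset.prod_univ_sum (t := U) (f := fun i y => if x i = y then Q else if i ∈ T then 0 else 1)]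
  have h2 : ∀ i, ∑ y ∈ U i, (if x i = y then Q else if i ∈ T then (0:ℝ) else 1) ≤
      (if i ∈ T then Q / u else 1) * (u + Q) := by
    intro i
    by_cases hi : i ∈ T
    · simp only [hi, if_true]
      calc _ ≤ Q := by
            rw [Finset.sum_ite_eq]; split_ifs <;> linarith
        _ ≤ Q / u * (u + Q) := by
            rw [div_mul_eq_mul_div, le_div_iff₀ (by linarith)]
            nlinarith
    · simp only [hi, if_false, one_mul]
      calc _ ≤ ∑ y ∈ U i, ((if x i = y then Q else 0) + 1) := by
            refine Finset.sum_le_sum fun y _ => ?_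
            split_ifs <;> linarith
        _ ≤ _ := by
            rw [Finset.sum_add_distrib, Finset.sum_ite_eq]
            simp only [Finset.sum_const, hUc, nsmul_eq_mul, mul_one]
            split_ifs <;> linarith
  refine (Finset.prod_le_prod (fun i _ => ?_) (fun i _ => h2 i)).trans ?_
  · refine Finset.sum_nonneg fun y _ => ?_
    split_ifs <;> linarith
  · rw [Finset.prod_mul_distrib, Finset.prod_ite]
    simp [div_pow]

lemma pairsum' {V : Type*} {K u : ℕ} (hu : 1 ≤ u) (U : Fin K → Finset V) (hUc : ∀ i, (U i).card = u)
    (x : Fin K → V) (Q : ℝ) (hQ : 0 < Q) (hKQ : K * Q ≤ u) (T : Finset (Fin K)) :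
    ∑ x' ∈ Fintype.piFinset U, (if T ⊆ (Finset.univ.filter fun i => x i = x' i) then
      Q ^ (Finset.univ.filter fun i => x i = x' i).card else 0) ≤ (Q / u) ^ T.card * (3 * u ^ K) := by
  have hu' : (1:ℝ) ≤ u := by exact_mod_cast hu
  refine (pairsum hu U hUc x Q hQ T).trans ?_
  refine mul_le_mul_of_nonneg_left ?_ (by positivity)
  have h1 : (u + Q : ℝ) = u * (1 + Q / u) := by field_simp
  rw [h1, mul_pow, mul_comm]
  refine mul_le_mul_of_nonneg_right ?_ (by positivity)
  calc (1 + Q / u) ^ K ≤ (Real.exp (Q / u)) ^ K := by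
        gcongr
        linarith [Real.add_one_le_exp (Q / u)]
    _ = Real.exp (K * (Q / u)) := by rw [Real.exp_nat_mul]
    _ ≤ Real.exp 1 := by
        apply Real.exp_le_exp.2
        rw [← mul_div_assoc, div_le_one (by linarith)]; exact hKQ
    _ ≤ 3 := by linarith [Real.exp_one_lt_d9]

noncomputable def qp {V : Type*} (p : ℝ) (e : Sym2 V) : ℝ := if e.IsDiag then 0 else p

lemma templ_diag {V : Type*} {t K : ℕ}
    (U : Fin K → Finset V) (hU : ∀ i j, i ≠ j → Disjoint (U i) (U j))
    (N : Fin t → Fin K → Finset V) (I : Fin t → SimpleGraph (Fin K))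
    (hN : ∀ τ i j, Disjoint (N τ i) (U j)) :
    ∀ τ, ∀ x ∈ Fintype.piFinset U, ∀ e ∈ tEdges (N τ) (I τ) x, ¬ e.IsDiag := by
  have hUU : ∀ i j v, v ∈ U i → v ∈ U j → i = j := by
    intro i j v h1 h2
    by_contra h
    exact (Finset.disjoint_left.1 (hU i j h) h1 h2)
  intro τ x hx e he
  rw [Fintype.mem_piFinset] at hx
  rw [mem_tEdges] at he
  rcases he with ⟨i, y, hy, rfl⟩ | ⟨i, j, hij, rfl⟩
  · rw [Sym2.mk_isDiag_iff]
    intro h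
    exact Finset.disjoint_left.1 (hN τ i i) hy (h ▸ hx i)
  · rw [Sym2.mk_isDiag_iff]
    intro h
    have := hUU i j _ (hx i) (h ▸ hx j)
    exact hij.ne this

lemma templ_term {V : Type*} {t K d : ℕ} (p : ℝ) (hp0 : 0 < p) (hp1 : p ≤ 1)
    (U : Fin K → Finset V) (hU : ∀ i j, i ≠ j → Disjoint (U i) (U j))
    (N : Fin t → Fin K → Finset V) (I : Fin t → SimpleGraph (Fin K))
    (hN : ∀ τ i j, Disjoint (N τ i) (U j))
    (hNN : ∀ τ τ', τ ≠ τ' → ∀ i j, Disjoint (N τ i) (N τ' j))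
    (hdeg : ∀ τ i, dg (I τ) i ≤ 2) (hdd : ∀ τ i, 2 * (N τ i).card + dg (I τ) i ≤ 2 * d)
    (τ τ' : Fin t) (x x' : Fin K → V) (hx : x ∈ Fintype.piFinset U) (hx' : x' ∈ Fintype.piFinset U) :
    (if (tEdges (N τ) (I τ) x ∩ tEdges (N τ') (I τ') x').Nonempty then
        (∏ e ∈ tEdges (N τ) (I τ) x ∩ tEdges (N τ') (I τ') x', qp p e)⁻¹ else 0) ≤
      (if τ = τ' then ∑ i, (if {i} ⊆ (Finset.univ.filter fun i => x i = x' i) then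
          ((p ^ d)⁻¹) ^ (Finset.univ.filter fun i => x i = x' i).card else 0) else 0) +
      ∑ ij ∈ (Finset.univ.filter fun ij : Fin K × Fin K => ij.1 ≠ ij.2),
        (if {ij.1, ij.2} ⊆ (Finset.univ.filter fun i => x i = x' i) then
          (p⁻¹) ^ (Finset.univ.filter fun i => x i = x' i).card else 0) := by
  have hdiag := templ_diag U hU N I hN
  set F := Finset.univ.filter fun i => x i = x' i with hF
  have hx1 := Fintype.mem_piFinset.1 hx
  have hx1' := Fintype.mem_piFinset.1 hx'
  have hsum2 : 0 ≤ ∑ ij ∈ (Finset.univ.filter fun ij : Fin K × Fin K => ij.1 ≠ ij.2),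
      (if {ij.1, ij.2} ⊆ F then (p⁻¹) ^ F.card else 0) :=
    Finset.sum_nonneg fun ij _ => by split_ifs <;> positivity
  have hsum1 : 0 ≤ ∑ i, (if {i} ⊆ F then ((p ^ d)⁻¹) ^ F.card else 0) :=
    Finset.sum_nonneg fun ij _ => by split_ifs <;> positivity
  by_cases hne : (tEdges (N τ) (I τ) x ∩ tEdges (N τ') (I τ') x').Nonempty
  · rw [if_pos hne]
    have hprod : ∏ e ∈ tEdges (N τ) (I τ) x ∩ tEdges (N τ') (I τ') x', qp p e =
        p ^ (tEdges (N τ) (I τ) x ∩ tEdges (N τ') (I τ') x').card := by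
      refine Finset.prod_eq_pow_card fun e he => ?_
      have := hdiag τ x hx e (Finset.mem_inter.1 he).1
      simp [qp, this]
    rw [hprod]
    have hc := inter_card U hU (N τ) (N τ') (I τ) (I τ') (hN τ) (hN τ') x x' hx1 hx1'
    have hpos := Finset.card_pos.2 hne
    change 0 < (tEdges (N τ) (I τ) x ∩ tEdges (N τ') (I τ') x').card at hpos
    change (p ^ (tEdges (N τ) (I τ) x ∩ tEdges (N τ') (I τ') x').card)⁻¹ ≤ _
    set m := (tEdges (N τ) (I τ) x ∩ tEdges (N τ') (I τ') x').card with hm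
    by_cases hτ : τ = τ'
    · subst hτ
      simp only [if_true]
      have h2 : 2 * m ≤ ∑ i ∈ F, 2 * d := by
        refine hc.trans (Finset.sum_le_sum fun i _ => ?_)
        rw [Finset.inter_self]; exact hdd τ i
      rw [Finset.sum_const, smul_eq_mul] at h2
      have h3 : m ≤ d * F.card := by nlinarith
      have hFne : F.Nonempty := by
        rw [← Finset.card_pos]
        rcases Nat.eq_zero_or_pos F.card with h | h
        · rw [h] at h3; omega
        · exact h
      obtain ⟨i, hi⟩ := hFne
      have h4 : (p ^ m)⁻¹ ≤ ((p ^ d)⁻¹) ^ F.card := by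
        rw [inv_pow, ← pow_mul]
        apply inv_anti₀ (by positivity)
        exact pow_le_pow_of_le_one hp0.le hp1 h3
      have h5 : ((p ^ d)⁻¹) ^ F.card ≤ ∑ i, (if {i} ⊆ F then ((p ^ d)⁻¹) ^ F.card else 0) := by
        refine le_trans (le_of_eq ?_) (Finset.single_le_sum (f := fun i => if {i} ⊆ F then ((p ^ d)⁻¹) ^ F.card else 0)
          (fun j _ => ?_) (Finset.mem_univ i))
        · simp only [Finset.singleton_subset_iff, hi, if_true]
        · split_ifs <;> positivity
      linarith
    · rw [if_neg hτ, zero_add]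
      have hemp : ∀ i, N τ i ∩ N τ' i = ∅ := fun i =>
        Finset.disjoint_iff_inter_eq_empty.1 (hNN τ τ' hτ i i)
      have h2 : 2 * m ≤ ∑ i ∈ F, 2 := by
        refine hc.trans (Finset.sum_le_sum fun i _ => ?_)
        rw [hemp]; simpa using hdeg τ i
      rw [Finset.sum_const, smul_eq_mul] at h2
      have h3 : m ≤ F.card := by omega
      have h4 : (p ^ m)⁻¹ ≤ (p⁻¹) ^ F.card := by
        rw [inv_pow]
        apply inv_anti₀ (by positivity)
        exact pow_le_pow_of_le_one hp0.le hp1 h3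
      have hex : ∃ i j, i ≠ j ∧ i ∈ F ∧ j ∈ F := by
        obtain ⟨e, he⟩ := Finset.card_pos.1 hpos
        have := inter_sub U hU (N τ) (N τ') (I τ) (I τ') (hN τ) (hN τ') x x' hx1 hx1' he
        rw [Finset.mem_union] at this
        rcases this with h | h
        · simp [hemp] at h
        · rw [Finset.mem_image] at h
          obtain ⟨e', he', _⟩ := h
          induction e' using Sym2.ind with
          | _ i j =>
            rw [SimpleGraph.mem_edgeFinset, SimpleGraph.mem_edgeSet] at he'
            exact ⟨i, j, he'.1.ne, he'.2.1, he'.2.2⟩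
      obtain ⟨i, j, hij, hi, hj⟩ := hex
      refine h4.trans ?_
      refine le_trans (le_of_eq ?_) (Finset.single_le_sum (f := fun ij : Fin K × Fin K => if {ij.1, ij.2} ⊆ F then (p⁻¹) ^ F.card else 0)
          (fun j _ => ?_) (a := (i, j)) ?_)
      · simp only [Finset.insert_subset_iff, Finset.singleton_subset_iff, hi, hj, and_self, if_true]
      · split_ifs <;> positivity
      · simp [hij]
  · rw [if_neg hne]
    split_ifs <;> linarith

set_option maxHeartbeats 1000000 in
theorem templ_prob {V : Type*} [Fintype V] {t K u M d : ℕ} (p : ℝ) (hp0 : 0 < p) (hp1 : p ≤ 1)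
    (ht : 1 ≤ t) (hd : 2 ≤ d) (hK : 1 ≤ K) (hu : 1 ≤ u) (hM : 1 ≤ M)
    (hKL : (K : ℝ) ≤ u * p ^ d) (htM : t ≤ M * u)
    (U : Fin K → Finset V) (hU : ∀ i j, i ≠ j → Disjoint (U i) (U j)) (hUc : ∀ i, (U i).card = u)
    (N : Fin t → Fin K → Finset V) (I : Fin t → SimpleGraph (Fin K))
    (hN : ∀ τ i j, Disjoint (N τ i) (U j))
    (hNN : ∀ τ τ', τ ≠ τ' → ∀ i j, Disjoint (N τ i) (N τ' j))
    (hdeg : ∀ τ i, dg (I τ) i ≤ 2) (hdd : ∀ τ i, 2 * (N τ i).card + dg (I τ) i ≤ 2 * d) :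
    ∑ A : Finset (Sym2 V), wt (qp p) A *
      (if ∀ τ, ∀ x ∈ Fintype.piFinset U, ¬ tEdges (N τ) (I τ) x ⊆ A then 1 else 0) ≤
      Real.exp (-(t * (u * p ^ d / (12 * K ^ 2 * M)))) := by
  have hu' : (1:ℝ) ≤ u := by exact_mod_cast hu
  have hK' : (1:ℝ) ≤ K := by exact_mod_cast hK
  have hM' : (1:ℝ) ≤ M := by exact_mod_cast hM
  have ht' : (1:ℝ) ≤ t := by exact_mod_cast ht
  have hL : 0 < u * p ^ d := by positivity
  have hdiag := templ_diag U hU N I hN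
  let Ix := Fin t × ↥(Fintype.piFinset U)
  let S : Ix → Finset (Sym2 V) := fun a => tEdges (N a.1) (I a.1) a.2.1
  set D : ℝ := t * u ^ K * (3 * u ^ K) * (K * (1 / (u * p ^ d)) + t * (K ^ 2 * (1 / (u * p) ^ 2))) with hDdef
  have hDpos : 0 < D := by positivity
  have hpd : 0 < p ^ d := by positivity
  have hterm : ∀ a b : Ix, (if (S a ∩ S b).Nonempty then (∏ e ∈ S a ∩ S b, qp p e)⁻¹ else 0) ≤
      (if a.1 = b.1 then ∑ i, (if {i} ⊆ (Finset.univ.filter fun i => a.2.1 i = b.2.1 i) then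
          ((p ^ d)⁻¹) ^ (Finset.univ.filter fun i => a.2.1 i = b.2.1 i).card else 0) else 0) +
      ∑ ij ∈ (Finset.univ.filter fun ij : Fin K × Fin K => ij.1 ≠ ij.2),
        (if {ij.1, ij.2} ⊆ (Finset.univ.filter fun i => a.2.1 i = b.2.1 i) then
          (p⁻¹) ^ (Finset.univ.filter fun i => a.2.1 i = b.2.1 i).card else 0) := by
    rintro ⟨τ, x, hx⟩ ⟨τ', x', hx'⟩
    exact templ_term p hp0 hp1 U hU N I hN hNN hdeg hdd τ τ' x x' hx hx'
  have hQ1 : 0 < (p ^ d)⁻¹ := by positivity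
  have hQ2 : 0 < p⁻¹ := by positivity
  have hKQ1 : K * (p ^ d)⁻¹ ≤ u := by
    rw [← div_eq_mul_inv, div_le_iff₀ hpd]; exact hKL
  have hKQ2 : K * p⁻¹ ≤ u := by
    refine le_trans (mul_le_mul_of_nonneg_left ?_ (by linarith)) hKQ1
    apply inv_anti₀ (by positivity)
    calc p ^ d ≤ p ^ 1 := pow_le_pow_of_le_one hp0.le hp1 (by omega)
      _ = p := pow_one p
  have hDD : ∑ a, ∑ b, (if (S a ∩ S b).Nonempty then (∏ e ∈ S a ∩ S b, qp p e)⁻¹ else 0) ≤ D := by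
    have hrow : ∀ a, ∑ b, (if (S a ∩ S b).Nonempty then (∏ e ∈ S a ∩ S b, qp p e)⁻¹ else 0) ≤
        (3 * u ^ K) * (K * (1 / (u * p ^ d)) + t * (K ^ 2 * (1 / (u * p) ^ 2))) := by
      rintro ⟨τ, x, hx⟩
      refine (Finset.sum_le_sum fun b _ => hterm _ b).trans ?_
      rw [Finset.sum_add_distrib, mul_add]
      simp only
      refine add_le_add ?_ ?_
      · rw [Fintype.sum_prod_type]
        simp only
        rw [Finset.sum_eq_single τ]
        · simp only [if_true]
          rw [Finset.sum_coe_sort (Fintype.piFinset U) (fun x' => ∑ i, (if {i} ⊆ (Finset.univ.filter fun i => x i = x' i) then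
          ((p ^ d)⁻¹) ^ (Finset.univ.filter fun i => x i = x' i).card else 0)), Finset.sum_comm]
          refine (Finset.sum_le_sum fun i _ => pairsum' hu U hUc x _ hQ1 hKQ1 {i}).trans (le_of_eq ?_)
          simp only [Finset.card_singleton, pow_one, Finset.sum_const, Finset.card_univ, Fintype.card_fin, nsmul_eq_mul]
          field_simp
        · intro τ' _ hτ'
          simp [hτ'.symm]
        · simp
      · rw [Fintype.sum_prod_type]
        simp only
        rw [Finset.sum_const, Finset.card_univ, Fintype.card_fin, nsmul_eq_mul]
        rw [Finset.sum_coe_sort (Fintype.piFinset U) (fun x' => ∑ ij ∈ (Finset.univ.filter fun ij : Fin K × Fin K => ij.1 ≠ ij.2),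
        (if {ij.1, ij.2} ⊆ (Finset.univ.filter fun i => x i = x' i) then
          (p⁻¹) ^ (Finset.univ.filter fun i => x i = x' i).card else 0)), Finset.sum_comm]
        have h1 : ∀ ij ∈ (Finset.univ.filter fun ij : Fin K × Fin K => ij.1 ≠ ij.2),
            ∑ x' ∈ Fintype.piFinset U, (if {ij.1, ij.2} ⊆ (Finset.univ.filter fun i => x i = x' i) then
          (p⁻¹) ^ (Finset.univ.filter fun i => x i = x' i).card else 0) ≤ (p⁻¹ / u) ^ 2 * (3 * u ^ K) := by
          intro ij hij
          have := pairsum' hu U hUc x _ hQ2 hKQ2 {ij.1, ij.2}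
          rwa [Finset.card_pair (Finset.mem_filter.1 hij).2] at this
        have h2 := Finset.sum_le_sum h1
        have h3 : ((Finset.univ.filter fun ij : Fin K × Fin K => ij.1 ≠ ij.2).card : ℝ) ≤ K ^ 2 := by
          have : (Finset.univ.filter fun ij : Fin K × Fin K => ij.1 ≠ ij.2).card ≤ K * K := by
            refine (Finset.card_le_univ _).trans ?_
            simp
          rw [sq]; exact_mod_cast this
        calc _ ≤ (t:ℝ) * ∑ ij ∈ (Finset.univ.filter fun ij : Fin K × Fin K => ij.1 ≠ ij.2),
              (p⁻¹ / u) ^ 2 * (3 * u ^ K) := mul_le_mul_of_nonneg_left h2 (by linarith)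
          _ ≤ (t:ℝ) * (K ^ 2 * ((p⁻¹ / u) ^ 2 * (3 * u ^ K))) := by
              rw [Finset.sum_const, nsmul_eq_mul]
              gcongr
          _ = _ := by field_simp
    refine (Finset.sum_le_sum fun a _ => hrow a).trans (le_of_eq ?_)
    rw [Finset.sum_const, Finset.card_univ, nsmul_eq_mul]
    have : (Fintype.card Ix : ℝ) = t * u ^ K := by
      show (Fintype.card (Fin t × ↥(Fintype.piFinset U)) : ℝ) = _
      rw [Fintype.card_prod, Fintype.card_fin, Fintype.card_coe, Fintype.card_piFinset]
      simp [hUc]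
    rw [this, hDdef]; ring
  have hq01 : ∀ e : Sym2 V, 0 ≤ qp p e ∧ qp p e ≤ 1 := by
    intro e; unfold qp; split_ifs
    · norm_num
    · exact ⟨hp0.le, hp1⟩
  have hJ := janson (qp p) hq01 S (fun a e he => by
    have := hdiag a.1 a.2.1 a.2.2 e he
    simp [qp, this, hp0]) D hDpos (by convert hDD)
  have hcard : (Fintype.card Ix : ℝ) = t * u ^ K := by
    show (Fintype.card (Fin t × ↥(Fintype.piFinset U)) : ℝ) = _
    rw [Fintype.card_prod, Fintype.card_fin, Fintype.card_coe, Fintype.card_piFinset]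
    simp [hUc]
  have hiff : ∀ A : Finset (Sym2 V), (∀ τ, ∀ x ∈ Fintype.piFinset U, ¬ tEdges (N τ) (I τ) x ⊆ A) ↔
      ∀ a : Ix, ¬ S a ⊆ A := by
    intro A
    constructor
    · rintro h ⟨τ, x, hx⟩; exact h τ x hx
    · intro h τ x hx; exact h (τ, ⟨x, hx⟩)
  refine le_trans (le_of_eq (Finset.sum_congr rfl fun A _ => ?_)) (hJ.trans ?_)
  · congr 1
    by_cases h : ∀ a : Ix, ¬ S a ⊆ A
    · rw [if_pos h, if_pos ((hiff A).2 h)]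
    · rw [if_neg h, if_neg (fun h' => h ((hiff A).1 h'))]
  apply Real.exp_le_exp.2
  apply neg_le_neg
  rw [hcard]
  rw [le_div_iff₀ (by positivity), hDdef]
  have key : (K * (1 / (u * p ^ d)) + t * (K ^ 2 * (1 / (u * p) ^ 2))) ≤ 2 * (K ^ 2 * M / (u * p ^ d)) := by
    have k1 : K * (1 / (u * p ^ d)) ≤ K ^ 2 * M / (u * p ^ d) := by
      rw [mul_one_div]
      gcongr
      nlinarith
    have k2 : t * (K ^ 2 * (1 / (u * p) ^ 2)) ≤ K ^ 2 * M / (u * p ^ d) := by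
      rw [mul_one_div, mul_div_assoc', div_le_div_iff₀ (by positivity) hL]
      have k3 : p ^ d ≤ p ^ 2 := pow_le_pow_of_le_one hp0.le hp1 hd
      have k4 : (t:ℝ) ≤ M * u := by exact_mod_cast htM
      calc (t:ℝ) * K ^ 2 * (u * p ^ d) ≤ (M * u) * K ^ 2 * (u * p ^ 2) := by gcongr
        _ = _ := by ring
    linarith
  calc t * (u * p ^ d / (12 * K ^ 2 * M)) * (2 * (t * u ^ K * (3 * u ^ K) * (K * (1 / (u * p ^ d)) + t * (K ^ 2 * (1 / (u * p) ^ 2)))))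
      ≤ t * (u * p ^ d / (12 * K ^ 2 * M)) * (2 * (t * u ^ K * (3 * u ^ K) * (2 * (K ^ 2 * M / (u * p ^ d))))) := by
        gcongr
    _ = _ := by field_simp; ring


/-- probability of an event for a random edge set -/
noncomputable def PB {V : Type*} [Fintype V] (p : ℝ) (E : Finset (Sym2 V) → Prop) : ℝ :=
  ∑ A : Finset (Sym2 V), wt (qp p) A * (if E A then 1 else 0)

lemma qp01 {V : Type*} {p : ℝ} (hp0 : 0 ≤ p) (hp1 : p ≤ 1) :
    ∀ e : Sym2 V, 0 ≤ qp p e ∧ qp p e ≤ 1 := by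
  intro e; unfold qp; split_ifs
  · norm_num
  · exact ⟨hp0, hp1⟩

lemma PB_mono {V : Type*} [Fintype V] {p : ℝ} (hp0 : 0 ≤ p) (hp1 : p ≤ 1)
    {E E' : Finset (Sym2 V) → Prop} (h : ∀ A, E A → E' A) : PB p E ≤ PB p E' := by
  unfold PB
  refine Finset.sum_le_sum fun A _ => mul_le_mul_of_nonneg_left ?_ (wt_nonneg _ (qp01 hp0 hp1) A)
  by_cases h1 : E A
  · rw [if_pos h1, if_pos (h A h1)]
  · rw [if_neg h1]; split_ifs <;> norm_num

lemma PB_union {V β : Type*} [Fintype V] {p : ℝ} (hp0 : 0 ≤ p) (hp1 : p ≤ 1)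
    (B : Finset β) (E : β → Finset (Sym2 V) → Prop) :
    PB p (fun A => ∃ b ∈ B, E b A) ≤ ∑ b ∈ B, PB p (E b) := by
  unfold PB
  rw [Finset.sum_comm]
  refine Finset.sum_le_sum fun A _ => ?_
  rw [← Finset.mul_sum]
  refine mul_le_mul_of_nonneg_left ?_ (wt_nonneg _ (qp01 hp0 hp1) A)
  have hnn : ∀ b ∈ B, (0:ℝ) ≤ (if E b A then 1 else 0) := fun b _ => by split_ifs <;> norm_num
  by_cases h1 : ∃ b ∈ B, E b A
  · rw [if_pos h1]
    obtain ⟨b, hb, hE⟩ := h1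
    have := Finset.single_le_sum hnn hb
    rwa [if_pos hE] at this
  · rw [if_neg h1]
    exact Finset.sum_nonneg hnn

lemma small_card {V : Type*} [Fintype V] (k : ℕ) :
    (Finset.univ.filter fun s : Finset V => s.card ≤ k).card ≤ (Fintype.card V + 1) ^ k := by
  have h : (Finset.univ.filter fun s : Finset V => s.card ≤ k) ⊆
      (Finset.univ : Finset (Fin k → Option V)).image
        fun g => Finset.univ.filter fun v => ∃ i, g i = some v := by
    intro s hs
    rw [Finset.mem_filter] at hs
    rw [Finset.mem_image]
    refine ⟨fun i => s.toList[(i : ℕ)]?, Finset.mem_univ _, ?_⟩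
    ext v
    simp only [Finset.mem_filter, Finset.mem_univ, true_and]
    rw [← Finset.mem_toList, List.mem_iff_getElem?]
    constructor
    · rintro ⟨i, hi⟩; exact ⟨i, hi⟩
    · rintro ⟨i, hi⟩
      have h2 : i < s.toList.length := by
        by_contra hc
        rw [List.getElem?_eq_none (by omega)] at hi
        cases hi
      rw [Finset.length_toList] at h2
      exact ⟨⟨i, by omega⟩, hi⟩
  refine (Finset.card_le_card h).trans (Finset.card_image_le.trans ?_)
  simp

lemma graphs_card (K : ℕ) : Fintype.card (SimpleGraph (Fin K)) ≤ 2 ^ (K * K) := by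
  have : Function.Injective (fun G : SimpleGraph (Fin K) =>
      (Finset.univ.filter fun ij : Fin K × Fin K => G.Adj ij.1 ij.2)) := by
    intro G G' h
    ext i j
    have := Finset.ext_iff.1 h (i, j)
    simpa using this
  have h2 := Fintype.card_le_of_injective _ this
  simpa using h2

lemma exists_disjoint_subsets {V : Type*} (s : ℕ) : ∀ (k : ℕ) (W : Finset V), k * s ≤ W.card →
    ∃ U : Fin k → Finset V, (∀ i, U i ⊆ W) ∧ (∀ i, (U i).card = s) ∧
      ∀ i j, i ≠ j → Disjoint (U i) (U j) := by
  intro k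
  induction k with
  | zero => intro W _; exact ⟨fun i => i.elim0, fun i => i.elim0, fun i => i.elim0, fun i => i.elim0⟩
  | succ k ih =>
    intro W hW
    obtain ⟨T, hT, hTc⟩ := Finset.exists_subset_card_eq (s := W) (n := s) (by nlinarith)
    have h1 : k * s ≤ (W \ T).card := by
      rw [Finset.card_sdiff_of_subset hT, hTc]
      have : (k + 1) * s = k * s + s := by ring
      omega
    obtain ⟨U, hU1, hU2, hU3⟩ := ih (W \ T) h1
    have hTU : ∀ i, Disjoint T (U i) := fun i =>
      Finset.disjoint_of_subset_right (hU1 i) Finset.disjoint_sdiff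
    refine ⟨Fin.cons T U, ?_, ?_, ?_⟩
    · intro i
      refine Fin.cases ?_ (fun i => ?_) i
      · simpa using hT
      · simpa using (hU1 i).trans Finset.sdiff_subset
    · intro i
      refine Fin.cases ?_ (fun i => ?_) i
      · simpa using hTc
      · simpa using hU2 i
    · intro i j
      refine Fin.cases ?_ (fun i => ?_) i
      · refine Fin.cases ?_ (fun j => ?_) j
        · intro h; exact absurd rfl h
        · intro _; simpa using hTU j
      · refine Fin.cases ?_ (fun j => ?_) j
        · intro _; simpa using (hTU i).symm
        · intro h; simpa using hU3 i j (fun h' => h (by rw [h']))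

def StarP {V : Type*} [Fintype V] (A : Finset (Sym2 V)) (R : Finset V) (K u M d : ℕ) : Prop :=
  ∀ t : ℕ, 1 ≤ t → t ≤ Fintype.card V → ∀ X : Finset V, X.card ≤ M * t → K * u ≤ (R \ X).card →
    ∀ (N : Fin t → Fin K → Finset V) (I : Fin t → SimpleGraph (Fin K)),
      (∀ τ i, Disjoint (N τ i) (R \ X)) →
      (∀ τ τ', τ ≠ τ' → ∀ i j, Disjoint (N τ i) (N τ' j)) →
      (∀ τ i, dg (I τ) i ≤ 2) → (∀ τ i, 2 * (N τ i).card + dg (I τ) i ≤ 2 * d) →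
      ∃ τ, ∃ x : Fin K → V, Function.Injective x ∧ (∀ i, x i ∈ R \ X) ∧ tEdges (N τ) (I τ) x ⊆ A

lemma star_fail_t {V : Type*} [Fintype V] {K u M d : ℕ} (p : ℝ) (hp0 : 0 < p) (hp1 : p ≤ 1)
    (hd : 2 ≤ d) (hK : 1 ≤ K) (hu : 1 ≤ u) (hM : 1 ≤ M)
    (hKL : (K : ℝ) ≤ u * p ^ d) (hn : Fintype.card V ≤ M * u) (R : Finset V) (t : ℕ) (ht : 1 ≤ t)
    (htn : t ≤ Fintype.card V) :
    PB p (fun A => ∃ X : Finset V, X.card ≤ M * t ∧ K * u ≤ (R \ X).card ∧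
    ∃ (N : Fin t → Fin K → Finset V) (I : Fin t → SimpleGraph (Fin K)),
      (∀ τ i, Disjoint (N τ i) (R \ X)) ∧
      (∀ τ τ', τ ≠ τ' → ∀ i j, Disjoint (N τ i) (N τ' j)) ∧
      (∀ τ i, dg (I τ) i ≤ 2) ∧ (∀ τ i, 2 * (N τ i).card + dg (I τ) i ≤ 2 * d) ∧
      ¬ ∃ τ, ∃ x : Fin K → V, Function.Injective x ∧ (∀ i, x i ∈ R \ X) ∧ tEdges (N τ) (I τ) x ⊆ A) ≤
    (((Fintype.card V + 1) ^ (M * t) * (((Fintype.card V + 1) ^ d) ^ K * 2 ^ (K * K)) ^ t : ℕ) : ℝ) *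
      Real.exp (-(t * (u * p ^ d / (12 * K ^ 2 * M)))) := by
  set B : Finset (Finset V × (Fin t → (Fin K → Finset V) × SimpleGraph (Fin K))) :=
    (Finset.univ.filter fun s : Finset V => s.card ≤ M * t) ×ˢ
    (Fintype.piFinset fun _ : Fin t => (Fintype.piFinset fun _ : Fin K =>
      (Finset.univ.filter fun s : Finset V => s.card ≤ d)) ×ˢ Finset.univ) with hB
  have hBc : B.card ≤ (Fintype.card V + 1) ^ (M * t) * (((Fintype.card V + 1) ^ d) ^ K * 2 ^ (K * K)) ^ t := by
    rw [hB, Finset.card_product, Fintype.card_piFinset]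
    simp only [Finset.card_product, Fintype.card_piFinset, Finset.prod_const, Finset.card_univ, Fintype.card_fin]
    gcongr
    · exact small_card _
    · exact small_card _
    · exact graphs_card K
  set E : Finset V × (Fin t → (Fin K → Finset V) × SimpleGraph (Fin K)) → Finset (Sym2 V) → Prop :=
    fun b A => K * u ≤ (R \ b.1).card ∧ (∀ τ i, Disjoint ((b.2 τ).1 i) (R \ b.1)) ∧
      (∀ τ τ', τ ≠ τ' → ∀ i j, Disjoint ((b.2 τ).1 i) ((b.2 τ').1 j)) ∧
      (∀ τ i, dg (b.2 τ).2 i ≤ 2) ∧ (∀ τ i, 2 * ((b.2 τ).1 i).card + dg (b.2 τ).2 i ≤ 2 * d) ∧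
      ¬ ∃ τ, ∃ x : Fin K → V, Function.Injective x ∧ (∀ i, x i ∈ R \ b.1) ∧ tEdges (b.2 τ).1 (b.2 τ).2 x ⊆ A with hE
  have hEb : ∀ b ∈ B, PB p (E b) ≤ Real.exp (-(t * (u * p ^ d / (12 * K ^ 2 * M)))) := by
    rintro ⟨X, T⟩ _
    by_cases hc : K * u ≤ (R \ X).card ∧ (∀ τ i, Disjoint ((T τ).1 i) (R \ X)) ∧
      (∀ τ τ', τ ≠ τ' → ∀ i j, Disjoint ((T τ).1 i) ((T τ').1 j)) ∧
      (∀ τ i, dg (T τ).2 i ≤ 2) ∧ (∀ τ i, 2 * ((T τ).1 i).card + dg (T τ).2 i ≤ 2 * d)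
    · obtain ⟨h1, h2, h3, h4, h5⟩ := hc
      obtain ⟨U, hU1, hU2, hU3⟩ := exists_disjoint_subsets u K (R \ X) h1
      refine le_trans (PB_mono hp0.le hp1 (E' := fun A => ∀ τ, ∀ x ∈ Fintype.piFinset U,
          ¬ tEdges (T τ).1 (T τ).2 x ⊆ A) ?_) ?_
      · rintro A ⟨-, -, -, -, -, h⟩ τ x hx hsub
        rw [Fintype.mem_piFinset] at hx
        refine h ⟨τ, x, ?_, fun i => hU1 i (hx i), hsub⟩
        intro i j hij
        by_contra hne
        exact Finset.disjoint_left.1 (hU3 i j hne) (hx i) (hij ▸ hx j)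
      · have := templ_prob p hp0 hp1 ht hd hK hu hM hKL (htn.trans hn) U hU3 hU2
          (fun τ => (T τ).1) (fun τ => (T τ).2)
          (fun τ i j => Finset.disjoint_of_subset_right (hU1 j) (h2 τ i)) h3 h4 h5
        unfold PB
        refine le_trans (le_of_eq (Finset.sum_congr rfl fun A _ => ?_)) this
        congr 1
        split_ifs <;> rfl
    · have : PB p (E (X, T)) = 0 := by
        unfold PB
        refine Finset.sum_eq_zero fun A _ => ?_
        rw [if_neg, mul_zero]
        rintro ⟨h1, h2, h3, h4, h5, -⟩
        exact hc ⟨h1, h2, h3, h4, h5⟩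
      rw [this]; positivity
  refine le_trans (PB_mono hp0.le hp1 (E' := fun A => ∃ b ∈ B, E b A) ?_) ?_
  · rintro A ⟨X, hX, h1, N, I, h2, h3, h4, h5, h6⟩
    refine ⟨(X, fun τ => (N τ, I τ)), ?_, h1, h2, h3, h4, h5, h6⟩
    rw [hB]
    simp only [Finset.mem_product, Finset.mem_filter, Finset.mem_univ, true_and, Fintype.mem_piFinset, and_true]
    exact ⟨hX, fun τ i => by have := h5 τ i; omega⟩
  · refine (PB_union hp0.le hp1 B E).trans ?_
    refine (Finset.sum_le_sum hEb).trans ?_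
    rw [Finset.sum_const, nsmul_eq_mul]
    gcongr
    

lemma star_fail {V : Type*} [Fintype V] {K u M d : ℕ} (p : ℝ) (hp0 : 0 < p) (hp1 : p ≤ 1)
    (hd : 2 ≤ d) (hK : 1 ≤ K) (hu : 1 ≤ u) (hM : 1 ≤ M)
    (hKL : (K : ℝ) ≤ u * p ^ d) (hn : Fintype.card V ≤ M * u) (R : Finset V)
    (hmain : (M + d * K + 3) * Real.log (Fintype.card V + 1) + K * K ≤ u * p ^ d / (12 * K ^ 2 * M)) :
    PB p (fun A => ¬ StarP A R K u M d) ≤ Fintype.card V * Real.exp (-(3 * Real.log (Fintype.card V + 1))) := by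
  set n := Fintype.card V with hnV
  refine le_trans (PB_mono hp0.le hp1 (E' := fun A => ∃ t ∈ Finset.Icc 1 n, ∃ X : Finset V, X.card ≤ M * t ∧ K * u ≤ (R \ X).card ∧
    ∃ (N : Fin t → Fin K → Finset V) (I : Fin t → SimpleGraph (Fin K)),
      (∀ τ i, Disjoint (N τ i) (R \ X)) ∧
      (∀ τ τ', τ ≠ τ' → ∀ i j, Disjoint (N τ i) (N τ' j)) ∧
      (∀ τ i, dg (I τ) i ≤ 2) ∧ (∀ τ i, 2 * (N τ i).card + dg (I τ) i ≤ 2 * d) ∧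
      ¬ ∃ τ, ∃ x : Fin K → V, Function.Injective x ∧ (∀ i, x i ∈ R \ X) ∧ tEdges (N τ) (I τ) x ⊆ A) ?_) ?_
  · intro A hA
    unfold StarP at hA
    push Not at hA
    obtain ⟨t, h1, h2, X, h3, h4, N, I, h5, h6, h7, h8, h9⟩ := hA
    refine ⟨t, Finset.mem_Icc.2 ⟨h1, h2⟩, X, h3, h4, N, I, h5, h6, h7, h8, ?_⟩
    rintro ⟨τ, x, a, b, c⟩
    exact h9 τ x a b c
  · refine (PB_union hp0.le hp1 _ _).trans ?_
    have : ∀ t ∈ Finset.Icc 1 n, _ := fun t ht => star_fail_t p hp0 hp1 hd hK hu hM hKL hn R t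
      (Finset.mem_Icc.1 ht).1 (Finset.mem_Icc.1 ht).2
    refine (Finset.sum_le_sum this).trans ?_
    have hb : ∀ t ∈ Finset.Icc 1 n, (((Fintype.card V + 1) ^ (M * t) * (((Fintype.card V + 1) ^ d) ^ K * 2 ^ (K * K)) ^ t : ℕ) : ℝ) *
      Real.exp (-(t * (u * p ^ d / (12 * K ^ 2 * M)))) ≤ Real.exp (-(3 * Real.log (n + 1))) := by
      intro t ht
      have ht1 : (1:ℝ) ≤ t := by exact_mod_cast (Finset.mem_Icc.1 ht).1
      have hlog : 0 ≤ Real.log (n + 1) := Real.log_nonneg (by linarith [(Nat.cast_nonneg n : (0:ℝ) ≤ n)])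
      have hexp : (n + 1 : ℝ) = Real.exp (Real.log (n + 1)) := (Real.exp_log (by positivity)).symm
      have h2e : (2:ℝ) ≤ Real.exp 1 := by linarith [Real.add_one_le_exp (1:ℝ)]
      have e1 : (((n + 1) ^ (M * t) * (((n + 1) ^ d) ^ K * 2 ^ (K * K)) ^ t : ℕ) : ℝ) ≤
          Real.exp (t * ((M + d * K) * Real.log (n + 1) + K * K)) := by
        push_cast
        calc ((n:ℝ) + 1) ^ (M * t) * ((((n:ℝ) + 1) ^ d) ^ K * 2 ^ (K * K)) ^ t
            ≤ (Real.exp (Real.log (n + 1))) ^ (M * t) * (((Real.exp (Real.log (n + 1))) ^ d) ^ K * (Real.exp 1) ^ (K * K)) ^ t := by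
              rw [← hexp]; gcongr
          _ = _ := by
              simp only [← Real.exp_nat_mul, ← Real.exp_add]
              congr 1; push_cast; ring
      calc _ ≤ Real.exp (t * ((M + d * K) * Real.log (n + 1) + K * K)) * Real.exp (-(t * (u * p ^ d / (12 * K ^ 2 * M)))) := by
            gcongr
        _ ≤ _ := by
            rw [← Real.exp_add]
            apply Real.exp_le_exp.2
            nlinarith
    refine (Finset.sum_le_sum hb).trans ?_
    rw [Finset.sum_const, Nat.card_Icc, nsmul_eq_mul]
    simp


lemma wt_eq {ι : Type*} [Fintype ι] (q : ι → ℝ) (A : Finset ι) :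
    wt q A = (∏ e ∈ A, q e) * ∏ e ∈ Finset.univ.filter (fun e => ¬ e ∈ A), (1 - q e) := by
  unfold wt
  rw [Finset.prod_ite]
  congr 1
  congr 1; ext; simp

lemma wt_edge {n : ℕ} (p : ℝ) (G : SimpleGraph (Fin n)) :
    wt (qp p) G.edgeFinset = p ^ edgeCount G * (1 - p) ^ (n.choose 2 - edgeCount G) := by
  have hc : edgeCount G = G.edgeFinset.card := by
    unfold edgeCount
    rw [Nat.card_eq_fintype_card, SimpleGraph.edgeFinset_card]
  have hnd : ∀ e ∈ G.edgeFinset, ¬ e.IsDiag := fun e he =>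
    G.not_isDiag_of_mem_edgeSet (SimpleGraph.mem_edgeFinset.1 he)
  have hfull : (Finset.univ.filter fun e : Sym2 (Fin n) => ¬ e.IsDiag).card = n.choose 2 := by
    have := Sym2.card_subtype_not_diag (α := Fin n)
    rw [Fintype.card_subtype, Fintype.card_fin] at this
    convert this
  rw [wt_eq, hc]
  congr 1
  · rw [Finset.prod_eq_pow_card (b := p)]
    · intro e he
      have := hnd e he
      simp [qp, this]
  · have h1 : ∀ e : Sym2 (Fin n), 1 - qp p e = if ¬ e.IsDiag then (1 - p) else 1 := by
      intro e; unfold qp; split_ifs <;> simp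
    simp only [h1]
    rw [Finset.prod_ite, Finset.prod_const_one, mul_one, Finset.prod_const]
    congr 1
    have h2 : (Finset.univ.filter fun e : Sym2 (Fin n) => ¬ e ∈ G.edgeFinset).filter (fun e => ¬ e.IsDiag) =
        (Finset.univ.filter fun e : Sym2 (Fin n) => ¬ e.IsDiag) \ G.edgeFinset := by
      ext e; simp only [Finset.mem_filter, Finset.mem_univ, true_and, Finset.mem_sdiff]; tauto
    refine (congrArg Finset.card (Eq.trans (by ext e; simp) h2)).trans ?_
    rw [Finset.card_sdiff_of_subset, hfull]
    intro e he
    simp only [Finset.mem_filter, Finset.mem_univ, true_and]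
    exact hnd e he

lemma gnp_eq {n : ℕ} (p : ℝ) (P : SimpleGraph (Fin n) → Prop) :
    gnpProb n p P = PB p (fun A : Finset (Sym2 (Fin n)) => P (SimpleGraph.fromEdgeSet (A : Set (Sym2 (Fin n))))) := by
  unfold gnpProb PB
  have hinj : Function.Injective (fun G : SimpleGraph (Fin n) => G.edgeFinset) := by
    intro G G' h
    exact SimpleGraph.edgeFinset_inj.1 h
  rw [← Finset.sum_subset (Finset.subset_univ ((Finset.univ : Finset (SimpleGraph (Fin n))).image (fun G : SimpleGraph (Fin n) => G.edgeFinset)))]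
  · rw [Finset.sum_image (fun a _ b _ h => hinj h)]
    refine Finset.sum_congr rfl fun G _ => ?_
    beta_reduce
    rw [wt_edge, SimpleGraph.coe_edgeFinset, SimpleGraph.fromEdgeSet_edgeSet]
    split_ifs <;> simp
  · intro A _ hA
    have : ∃ e ∈ A, e.IsDiag := by
      by_contra hc
      push Not at hc
      apply hA
      rw [Finset.mem_image]
      obtain ⟨G, hG⟩ : ∃ G : SimpleGraph (Fin n), G.edgeSet = ↑A \ {e : Sym2 (Fin n) | e.IsDiag} :=
        ⟨SimpleGraph.fromEdgeSet (A : Set (Sym2 (Fin n))), SimpleGraph.edgeSet_fromEdgeSet _⟩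
      refine ⟨G, Finset.mem_univ _, ?_⟩
      ext e
      rw [SimpleGraph.mem_edgeFinset, hG]
      simp only [Set.mem_sdiff, Finset.mem_coe]
      constructor
      · exact fun h => h.1
      · exact fun h => ⟨h, hc e h⟩
    obtain ⟨e, he, hd⟩ := this
    have : wt (qp p) A = 0 := by
      unfold wt
      refine Finset.prod_eq_zero (Finset.mem_univ e) ?_
      rw [if_pos he]; simp [qp, hd]
    rw [this, zero_mul]

lemma PB_compl {V : Type*} [Fintype V] {p : ℝ} (E : Finset (Sym2 V) → Prop) :
    PB p E = 1 - PB p (fun A => ¬ E A) := by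
  have : PB p E + PB p (fun A => ¬ E A) = 1 := by
    unfold PB
    rw [← Finset.sum_add_distrib]
    refine Eq.trans ?_ (sum_wt (qp p : Sym2 V → ℝ))
    refine Finset.sum_congr rfl fun A _ => ?_
    by_cases h : E A <;> simp [h]
  linarith

lemma PB_nonneg {V : Type*} [Fintype V] {p : ℝ} (hp0 : 0 ≤ p) (hp1 : p ≤ 1) (E : Finset (Sym2 V) → Prop) :
    0 ≤ PB p E := by
  unfold PB
  refine Finset.sum_nonneg fun A _ => mul_nonneg (wt_nonneg _ (qp01 hp0 hp1) A) ?_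
  split_ifs <;> norm_num


/-- degree of `v` into the set `C` -/
noncomputable def degIn {W : Type*} (H : SimpleGraph W) (C : Finset W) (v : W) : ℕ :=
  (C.filter fun w => H.Adj v w).card

lemma degIn_erase {W : Type*} (H : SimpleGraph W) (B : Finset W) (w : W) (hw : w ∈ B) :
    ∑ v ∈ B, degIn H B v = ∑ v ∈ B.erase w, degIn H (B.erase w) v + 2 * degIn H B w := by
  have h1 : ∀ v ∈ B.erase w, degIn H B v = degIn H (B.erase w) v + if H.Adj w v then 1 else 0 := by
    intro v hv
    unfold degIn
    conv_lhs => rw [← Finset.insert_erase hw]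
    rw [Finset.filter_insert]
    by_cases h : H.Adj w v
    · rw [if_pos h.symm, if_pos h, Finset.card_insert_of_notMem (by simp)]
    · rw [if_neg (fun h' => h h'.symm), if_neg h, add_zero]
  rw [← Finset.add_sum_erase _ _ hw, Finset.sum_congr rfl h1, Finset.sum_add_distrib]
  have h2 : ∑ v ∈ B.erase w, (if H.Adj w v then 1 else 0) = degIn H B w := by
    rw [← Finset.card_filter]
    unfold degIn
    congr 1
    ext v
    simp only [Finset.mem_filter, Finset.mem_erase]
    constructor
    · exact fun h => ⟨h.1.2, h.2⟩
    · exact fun h => ⟨⟨h.2.ne', h.1⟩, h.2⟩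
  rw [h2]; ring

lemma exists_two_regular {W : Type*} [Fintype W] (H : SimpleGraph W) (A : Finset W) (hA : A.Nonempty)
    (hdeg : ∀ v ∈ A, 2 ≤ degIn H A v) :
    ∃ B ⊆ A, B.Nonempty ∧ ∀ v ∈ B, degIn H B v = 2 := by
  set F := A.powerset.filter (fun B => B.Nonempty ∧ 2 * B.card ≤ ∑ v ∈ B, degIn H B v) with hF
  have hne : F.Nonempty := by
    refine ⟨A, ?_⟩
    rw [hF, Finset.mem_filter, Finset.mem_powerset]
    refine ⟨Finset.Subset.refl _, hA, ?_⟩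
    have := Finset.sum_le_sum hdeg
    rw [Finset.sum_const, smul_eq_mul] at this
    omega
  obtain ⟨B, hB, hmin⟩ := Finset.exists_min_image F Finset.card hne
  rw [hF, Finset.mem_filter, Finset.mem_powerset] at hB
  obtain ⟨hBA, hBne, hBs⟩ := hB
  refine ⟨B, hBA, hBne, ?_⟩
  have hpar : ∀ C : Finset W, 2 * (restr H C).edgeFinset.card = ∑ v ∈ C, degIn H C v :=
    fun C => two_card_restr H C
  obtain ⟨k, hk⟩ : ∃ k, ∑ v ∈ B, degIn H B v = 2 * B.card + 2 * k := by
    have := hpar B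
    exact ⟨(restr H B).edgeFinset.card - B.card, by omega⟩
  have hge : ∀ w ∈ B, 2 + k ≤ degIn H B w := by
    intro w hw
    have h1 := degIn_erase H B w hw
    have h2 := hpar (B.erase w)
    have h3 := Finset.card_erase_add_one hw
    rcases (B.erase w).eq_empty_or_nonempty with he | he
    · rw [he] at h1 h3
      simp only [Finset.sum_empty, Finset.card_empty] at h1 h3
      have : degIn H B w = 0 := by
        unfold degIn
        rw [Finset.card_eq_zero, Finset.filter_eq_empty_iff]
        intro v hv hadj
        have : v ∈ B.erase w := Finset.mem_erase.2 ⟨hadj.ne', hv⟩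
        rw [he] at this
        simp at this
      omega
    · have : ¬ 2 * (B.erase w).card ≤ ∑ v ∈ B.erase w, degIn H (B.erase w) v := by
        intro h
        have := hmin (B.erase w) (by
          rw [hF, Finset.mem_filter, Finset.mem_powerset]
          exact ⟨(Finset.erase_subset _ _).trans hBA, he, h⟩)
        omega
      omega
  have hsum := Finset.sum_le_sum hge
  rw [Finset.sum_const, smul_eq_mul, hk] at hsum
  have hB3 : 3 ≤ B.card := by
    obtain ⟨w, hw⟩ := hBne
    have h1 := hge w hw
    have h2 : degIn H B w ≤ (B.erase w).card := by
      unfold degIn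
      refine Finset.card_le_card fun v hv => ?_
      rw [Finset.mem_filter] at hv
      exact Finset.mem_erase.2 ⟨hv.2.ne', hv.1⟩
    have h3 := Finset.card_erase_add_one hw
    omega
  have hk0 : k = 0 := by
    by_contra h
    have : 1 ≤ k := by omega
    nlinarith
  subst hk0
  intro v hv
  by_contra hne
  have hlt : ∑ v ∈ B, 2 < ∑ v ∈ B, degIn H B v :=
    Finset.sum_lt_sum (fun w hw => by have := hge w hw; omega) ⟨v, hv, by have := hge v hv; omega⟩
  rw [Finset.sum_const, smul_eq_mul, hk] at hlt
  omega

/-- distance at most `k` to `S` -/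
def dS {W : Type*} (H : SimpleGraph W) (S : W → Prop) : ℕ → W → Prop
  | 0, v => S v
  | k + 1, v => dS H S k v ∨ ∃ w, H.Adj v w ∧ dS H S k w

lemma dS_mono {W : Type*} (H : SimpleGraph W) (S : W → Prop) {k l : ℕ} (h : k ≤ l) (v : W)
    (hv : dS H S k v) : dS H S l v := by
  induction h with
  | refl => exact hv
  | step _ ih => exact Or.inl ih

/-- states of the nonbacktracking walk -/
def walkSt {W : Type*} (next : W → W → Bool → W) (v : W) (b : ℕ → Bool) : ℕ → W × W
  | 0 => (v, v)
  | k + 1 => ((walkSt next v b k).2, next (walkSt next v b k).1 (walkSt next v b k).2 (b k))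

lemma walkSt_fst {W : Type*} (next : W → W → Bool → W) (v : W) (b : ℕ → Bool) (k : ℕ) :
    (walkSt next v b (k+1)).1 = (walkSt next v b k).2 := rfl

lemma exists_min_deg_two {W : Type*} [Fintype W] (H : SimpleGraph W) (S : W → Prop) (r : ℕ)
    (hr : Fintype.card W < 2 ^ r) (hS : ∀ v, ¬ S v → 3 ≤ degIn H Finset.univ v) (v : W)
    (hv : ¬ dS H S (r + 2) v) :
    ∃ A : Finset W, A.Nonempty ∧ A.card ≤ 2 * r + 2 ∧ (∀ a ∈ A, 2 ≤ degIn H A a) ∧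
      ∀ a ∈ A, ¬ dS H S 2 a := by
  have hnext : ∀ q w : W, ∃ f : Bool → W, ¬ S w → (∀ b, H.Adj w (f b) ∧ f b ≠ q) ∧ f true ≠ f false := by
    intro q w
    by_cases hw : S w
    · exact ⟨fun _ => q, fun h => absurd hw h⟩
    · have h1 := hS w hw
      unfold degIn at h1
      have h2 : 1 < ((Finset.univ.filter fun x => H.Adj w x).erase q).card := by
        have := Finset.pred_card_le_card_erase (s := Finset.univ.filter fun x => H.Adj w x) (a := q)
        omega
      obtain ⟨a, ha, b, hb, hab⟩ := Finset.one_lt_card.1 h2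
      simp only [Finset.mem_erase, Finset.mem_filter, Finset.mem_univ, true_and] at ha hb
      refine ⟨fun c => if c then a else b, fun _ => ⟨fun c => ?_, by simpa using hab⟩⟩
      cases c
      · simpa using ⟨hb.2, hb.1⟩
      · simpa using ⟨ha.2, ha.1⟩
  choose next hnext using hnext
  set st := walkSt next v with hst
  have hfar : ∀ b k, k ≤ r → ¬ dS H S (r + 2 - k) (st b k).2 := by
    intro b k
    induction k with
    | zero => intro _; simpa [hst, walkSt] using hv
    | succ k ih =>
      intro hk
      have h1 := ih (by omega)
      have h2 : ¬ S (st b k).2 := fun h => h1 (dS_mono H S (Nat.zero_le _) _ h)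
      have h3 := ((hnext (st b k).1 (st b k).2 h2).1 (b k)).1
      intro hc
      apply h1
      have : r + 2 - k = (r + 2 - (k + 1)) + 1 := by omega
      rw [this]
      exact Or.inr ⟨_, h3, hc⟩
  have hnS : ∀ b k, k ≤ r → ¬ S (st b k).2 := fun b k hk h =>
    hfar b k hk (dS_mono H S (Nat.zero_le _) _ h)
  have hadj : ∀ b k, k ≤ r → H.Adj (st b k).2 (st b (k+1)).2 := fun b k hk =>
    ((hnext (st b k).1 (st b k).2 (hnS b k hk)).1 (b k)).1
  have hnb : ∀ b k, k + 1 ≤ r → (st b k).2 ≠ (st b (k+2)).2 := fun b k hk =>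
    (((hnext (st b (k+1)).1 (st b (k+1)).2 (hnS b (k+1) hk)).1 (b (k+1))).2).symm
  obtain ⟨c, c', hcc, hend⟩ := Fintype.exists_ne_map_eq_of_card_lt
    (fun c : Fin r → Bool => (st (fun k => if h : k < r then c ⟨k, h⟩ else false) r).2)
    (by simpa using hr)
  set b : ℕ → Bool := fun k => if h : k < r then c ⟨k, h⟩ else false with hb
  set b' : ℕ → Bool := fun k => if h : k < r then c' ⟨k, h⟩ else false with hb'
  have hex : ∃ k, k < r ∧ b k ≠ b' k := by
    by_contra hcon
    push Not at hcon
    apply hcc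
    funext i
    have := hcon i.1 i.2
    simpa [hb, hb'] using this
  set i := Nat.find hex with hi
  obtain ⟨hir, hib⟩ := Nat.find_spec hex
  have hpre : ∀ k, k ≤ i → st b k = st b' k := by
    intro k
    induction k with
    | zero => intro _; rfl
    | succ k ih =>
      intro hk
      have h1 := ih (by omega)
      have h2 : b k = b' k := by
        have := Nat.find_min hex (m := k) (by omega)
        by_contra hne
        exact this ⟨by omega, hne⟩
      show ((st b k).2, next (st b k).1 (st b k).2 (b k)) = ((st b' k).2, next (st b' k).1 (st b' k).2 (b' k))
      rw [h1, h2]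
  have hdiff : (st b (i+1)).2 ≠ (st b' (i+1)).2 := by
    have h1 := (hnext (st b i).1 (st b i).2 (hnS b i (by omega))).2
    show next (st b i).1 (st b i).2 (b i) ≠ next (st b' i).1 (st b' i).2 (b' i)
    rw [← hpre i le_rfl]
    have : b i ≠ b' i := hib
    cases h3 : b i <;> cases h4 : b' i <;> simp_all
    exact fun e => h1 e.symm
  have hex2 : ∃ j, i < j ∧ j ≤ r ∧ (st b j).2 = (st b' j).2 := ⟨r, hir, le_rfl, hend⟩
  set j := Nat.find hex2 with hj
  obtain ⟨hij, hjr, hjeq⟩ := Nat.find_spec hex2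
  rw [← hj] at hij hjr hjeq
  have hjmin : ∀ k, i < k → k < j → (st b k).2 ≠ (st b' k).2 := by
    intro k h1 h2 h3
    exact Nat.find_min hex2 h2 ⟨h1, by omega, h3⟩
  have hij1 : i + 1 < j := by
    rcases Nat.lt_or_ge (i+1) j with h | h
    · exact h
    · have : j = i + 1 := by omega
      rw [this] at hjeq
      exact absurd hjeq hdiff
  set x : ℕ → W := fun k => (st b k).2 with hx
  set y : ℕ → W := fun k => (st b' k).2 with hy
  set A := (Finset.Icc i j).image x ∪ (Finset.Icc i j).image y with hA
  have hxA : ∀ k, i ≤ k → k ≤ j → x k ∈ A := fun k h1 h2 =>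
    Finset.mem_union_left _ (Finset.mem_image_of_mem _ (Finset.mem_Icc.2 ⟨h1, h2⟩))
  have hyA : ∀ k, i ≤ k → k ≤ j → y k ∈ A := fun k h1 h2 =>
    Finset.mem_union_right _ (Finset.mem_image_of_mem _ (Finset.mem_Icc.2 ⟨h1, h2⟩))
  have htwo : ∀ a p q : W, p ∈ A → q ∈ A → p ≠ q → H.Adj a p → H.Adj a q → 2 ≤ degIn H A a := by
    intro a p q hp hq hpq h1 h2
    unfold degIn
    apply Finset.one_lt_card.2
    exact ⟨p, Finset.mem_filter.2 ⟨hp, h1⟩, q, Finset.mem_filter.2 ⟨hq, h2⟩, hpq⟩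
  have hxi : x i = y i := by
    show (st b i).2 = (st b' i).2
    rw [hpre i le_rfl]
  have hgen : ∀ (z : ℕ → W), (∀ k, i ≤ k → k ≤ j → z k ∈ A) →
      (∀ k, k ≤ r → H.Adj (z k) (z (k+1))) → (∀ k, k + 1 ≤ r → z k ≠ z (k+2)) →
      z i = x i → z j = x j → ∀ k, i ≤ k → k ≤ j → 2 ≤ degIn H A (z k) := by
    intro z hzA hza hzn hzi hzj k h1 h2
    rcases Nat.eq_or_lt_of_le h1 with h | h
    · subst h
      rw [hzi]
      refine htwo _ (x (i+1)) (y (i+1)) (hxA _ (by omega) (by omega)) (hyA _ (by omega) (by omega)) hdiff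
        (hadj b i (by omega)) ?_
      rw [hxi]; exact hadj b' i (by omega)
    · rcases Nat.eq_or_lt_of_le h2 with h' | h'
      · rw [h', hzj]
        obtain ⟨l, hl⟩ : ∃ l, j = l + 1 := ⟨j - 1, by omega⟩
        have e1 : H.Adj (x l) (x (l+1)) := hadj b l (by omega)
        have e2 : H.Adj (y l) (y (l+1)) := hadj b' l (by omega)
        have e3 : x j = y j := hjeq
        rw [← hl] at e1 e2
        rw [← e3] at e2
        exact htwo _ (x l) (y l) (hxA _ (by omega) (by omega)) (hyA _ (by omega) (by omega))
          (hjmin l (by omega) (by omega)) e1.symm e2.symm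
      · obtain ⟨l, hl⟩ : ∃ l, k = l + 1 := ⟨k - 1, by omega⟩
        subst hl
        exact htwo _ (z l) (z (l+2)) (hzA _ (by omega) (by omega)) (hzA _ (by omega) (by omega))
          (hzn l (by omega)) (hza l (by omega)).symm (hza (l+1) (by omega))
  refine ⟨A, ⟨x i, hxA i le_rfl (by omega)⟩, ?_, ?_, ?_⟩
  · refine (Finset.card_union_le _ _).trans ?_
    have h1 := Finset.card_image_le (s := Finset.Icc i j) (f := x)
    have h2 := Finset.card_image_le (s := Finset.Icc i j) (f := y)
    rw [Nat.card_Icc] at h1 h2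
    omega
  · intro a ha
    rw [hA, Finset.mem_union, Finset.mem_image, Finset.mem_image] at ha
    rcases ha with ⟨k, hk, rfl⟩ | ⟨k, hk, rfl⟩
    · rw [Finset.mem_Icc] at hk
      exact hgen x hxA (hadj b) (hnb b) rfl rfl k hk.1 hk.2
    · rw [Finset.mem_Icc] at hk
      exact hgen y hyA (hadj b') (hnb b') hxi.symm hjeq.symm k hk.1 hk.2
  · have hfar2 : ∀ b k, k ≤ r → ¬ dS H S 2 (st b k).2 := fun b k hk h =>
      hfar b k hk (dS_mono H S (by omega) _ h)
    intro a ha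
    rw [hA, Finset.mem_union, Finset.mem_image, Finset.mem_image] at ha
    rcases ha with ⟨k, hk, rfl⟩ | ⟨k, hk, rfl⟩
    · rw [Finset.mem_Icc] at hk
      exact hfar2 b k (by omega)
    · rw [Finset.mem_Icc] at hk
      exact hfar2 b' k (by omega)

def sepV {W : Type*} (H : SimpleGraph W) (a b : W) : Prop :=
  a ≠ b ∧ ¬ H.Adj a b ∧ ∀ w, ¬ (H.Adj a w ∧ H.Adj b w)

lemma sepV.symm {W : Type*} {H : SimpleGraph W} {a b : W} (h : sepV H a b) : sepV H b a :=
  ⟨h.1.symm, fun h' => h.2.1 h'.symm, fun w hw => h.2.2 w ⟨hw.2, hw.1⟩⟩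

theorem structure_thm {W : Type*} [Fintype W] (H : SimpleGraph W) (Δ r : ℕ) (hΔ : 3 ≤ Δ)
    (hr : Fintype.card W < 2 ^ r) :
    ∃ 𝒞 : Finset (Finset W),
      (∀ C ∈ 𝒞, C.Nonempty ∧ C.card ≤ 2 * r + 2 ∧ ∀ v ∈ C, degIn H C v = 2) ∧
      (∀ C ∈ 𝒞, ∀ C' ∈ 𝒞, C ≠ C' → ∀ a ∈ C, ∀ b ∈ C', sepV H a b) ∧
      ∃ ρ : W → ℕ, (∀ v, ρ v ≤ r + 2) ∧
        ∀ v, (∀ C ∈ 𝒞, v ∉ C) → degIn H Finset.univ v < Δ ∨ ∃ w, H.Adj v w ∧ ρ w < ρ v := by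
  set good : Finset (Finset W) → Prop := fun 𝒞 =>
      (∀ C ∈ 𝒞, C.Nonempty ∧ C.card ≤ 2 * r + 2 ∧ ∀ v ∈ C, degIn H C v = 2) ∧
      (∀ C ∈ 𝒞, ∀ C' ∈ 𝒞, C ≠ C' → ∀ a ∈ C, ∀ b ∈ C', sepV H a b) with hgood
  obtain ⟨𝒞, h𝒞, hmax⟩ := Finset.exists_max_image (Finset.univ.filter good) Finset.card
    ⟨∅, by simp [hgood]⟩
  rw [Finset.mem_filter] at h𝒞
  obtain ⟨-, hg1, hg2⟩ := h𝒞
  refine ⟨𝒞, hg1, hg2, ?_⟩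
  set S : W → Prop := fun v => degIn H Finset.univ v < Δ ∨ ∃ C ∈ 𝒞, v ∈ C with hS
  have hall : ∀ v, dS H S (r + 2) v := by
    intro v
    by_contra hv
    obtain ⟨A, hA1, hA2, hA3, hA4⟩ := exists_min_deg_two H S r hr (fun v hv => by
      rw [hS] at hv
      push Not at hv
      exact hΔ.trans hv.1) v hv
    obtain ⟨B, hBA, hB1, hB2⟩ := exists_two_regular H A hA1 hA3
    have hnS : ∀ a ∈ B, ¬ S a := fun a ha h => hA4 a (hBA ha) (dS_mono H S (Nat.zero_le _) a h)
    have hsep : ∀ C ∈ 𝒞, ∀ a ∈ B, ∀ c ∈ C, sepV H a c := by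
      intro C hC a ha c hc
      have hcS : S c := Or.inr ⟨C, hC, hc⟩
      refine ⟨?_, ?_, ?_⟩
      · rintro rfl; exact hnS _ ha hcS
      · intro h
        exact hA4 a (hBA ha) (Or.inl (Or.inr ⟨c, h, hcS⟩))
      · rintro w ⟨h1, h2⟩
        exact hA4 a (hBA ha) (Or.inr ⟨w, h1, Or.inr ⟨c, h2.symm, hcS⟩⟩)
    have hB𝒞 : B ∉ 𝒞 := by
      intro h
      obtain ⟨a, ha⟩ := hB1
      exact hnS a ha (Or.inr ⟨B, h, ha⟩)
    have := hmax (insert B 𝒞) (by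
      rw [Finset.mem_filter]
      refine ⟨Finset.mem_univ _, ?_, ?_⟩
      · intro C hC
        rcases Finset.mem_insert.1 hC with rfl | hC
        · exact ⟨hB1, (Finset.card_le_card hBA).trans hA2, hB2⟩
        · exact hg1 C hC
      · intro C hC C' hC' hne a ha b hb
        rcases Finset.mem_insert.1 hC with h | h
        · rcases Finset.mem_insert.1 hC' with h' | h'
          · exact absurd (h.trans h'.symm) hne
          · rw [h] at ha; exact hsep C' h' a ha b hb
        · rcases Finset.mem_insert.1 hC' with h' | h'
          · rw [h'] at hb; exact (hsep C h b hb a ha).symm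
          · exact hg2 C h C' h' hne a ha b hb)
    rw [Finset.card_insert_of_notMem hB𝒞] at this
    omega
  have hex : ∀ v, ∃ k, dS H S k v := fun v => ⟨_, hall v⟩
  refine ⟨fun v => Nat.find (hex v), fun v => Nat.find_min' _ (hall v), ?_⟩
  intro v hv
  have hspec := Nat.find_spec (hex v)
  rcases hk : Nat.find (hex v) with _ | k
  · rw [hk] at hspec
    rcases hspec with h | ⟨C, hC, h⟩
    · exact Or.inl h
    · exact absurd h (hv C hC)
  · rw [hk] at hspec
    rcases hspec with h | ⟨w, hw, h⟩
    · exact absurd h (Nat.find_min (hex v) (by omega))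
    · refine Or.inr ⟨w, hw, ?_⟩
      have := Nat.find_min' (hex w) h
      show Nat.find (hex w) < Nat.find (hex v)
      omega

lemma greedy_col {W : Type*} (conf : W → W → Prop) (hsym : ∀ a b, conf a b → conf b a) (q : ℕ)
    (S : Finset W) (hq : ∀ v, (S.filter fun w => conf v w).card ≤ q) :
    ∃ col : W → ℕ, (∀ v, col v < q + 1) ∧ ∀ a ∈ S, ∀ b ∈ S, a ≠ b → conf a b → col a ≠ col b := by
  induction S using Finset.induction_on with
  | empty => exact ⟨fun _ => 0, fun _ => Nat.succ_pos _, by simp⟩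
  | insert v S hv ih =>
    obtain ⟨col, h1, h2⟩ := ih (fun w => (Finset.card_le_card
      (Finset.filter_subset_filter _ (Finset.subset_insert _ _))).trans (hq w))
    have hfree : ∃ c ∈ Finset.range (q + 1), c ∉ (S.filter fun w => conf v w).image col := by
      apply Finset.exists_mem_notMem_of_card_lt_card
      rw [Finset.card_range]
      have h3 := Finset.card_image_le (s := S.filter fun w => conf v w) (f := col)
      have h4 := Finset.card_le_card (Finset.filter_subset_filter (fun w => conf v w) (Finset.subset_insert v S))
      have h5 := hq v
      omega
    obtain ⟨c, hc1, hc2⟩ := hfree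
    rw [Finset.mem_range] at hc1
    have hc3 : ∀ w ∈ S, conf v w → col w ≠ c := by
      intro w hw hcw he
      exact hc2 (Finset.mem_image.2 ⟨w, Finset.mem_filter.2 ⟨hw, hcw⟩, he⟩)
    refine ⟨Function.update col v c, ?_, ?_⟩
    · intro w
      by_cases hw : w = v
      · subst hw; simpa using hc1
      · simpa [hw] using h1 w
    · intro a ha b hb hab hcf
      rcases Finset.mem_insert.1 ha with rfl | ha'
      · rcases Finset.mem_insert.1 hb with rfl | hb'
        · exact absurd rfl hab
        · simpa [hab.symm] using (hc3 b hb' hcf).symm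
      · rcases Finset.mem_insert.1 hb with rfl | hb'
        · simpa [hab] using hc3 a ha' (hsym _ _ hcf)
        · have e1 : a ≠ v := fun h => hv (h ▸ ha')
          have e2 : b ≠ v := fun h => hv (h ▸ hb')
          simpa [e1, e2] using h2 a ha' b hb' hab hcf

lemma exists_col {W : Type*} [Fintype W] (H : SimpleGraph W) (Δ : ℕ)
    (hdeg : ∀ v, degIn H Finset.univ v ≤ Δ) :
    ∃ col : W → ℕ, (∀ v, col v < Δ + Δ * Δ + 1) ∧ ∀ a b, a ≠ b → col a = col b → sepV H a b := by
  obtain ⟨col, h1, h2⟩ := greedy_col (fun a b => H.Adj a b ∨ ∃ w, H.Adj a w ∧ H.Adj b w)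
    (fun a b h => by
      rcases h with h | ⟨w, h, h'⟩
      · exact Or.inl h.symm
      · exact Or.inr ⟨w, h', h⟩) (Δ + Δ * Δ) Finset.univ (by
      intro v
      refine le_trans (Finset.card_le_card (t := (Finset.univ.filter fun w => H.Adj v w) ∪
          (Finset.univ.filter fun w => H.Adj v w).biUnion fun z => Finset.univ.filter fun w => H.Adj z w) ?_)
          ((Finset.card_union_le _ _).trans ?_)
      · intro w hw
        simp only [Finset.mem_filter, Finset.mem_univ, true_and] at hw
        simp only [Finset.mem_union, Finset.mem_filter, Finset.mem_univ, true_and, Finset.mem_biUnion]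
        rcases hw with h | ⟨z, h, h'⟩
        · exact Or.inl h
        · exact Or.inr ⟨z, h, h'.symm⟩
      refine add_le_add (hdeg v) ?_
      refine (Finset.card_biUnion_le).trans ?_
      refine (Finset.sum_le_sum fun z _ => hdeg z).trans ?_
      rw [Finset.sum_const, smul_eq_mul]
      exact Nat.mul_le_mul_right _ (hdeg v))
  refine ⟨col, h1, fun a b hab hc => ⟨hab, fun h => ?_, fun w hw => ?_⟩⟩
  · exact h2 a (Finset.mem_univ _) b (Finset.mem_univ _) hab (Or.inl h) hc
  · exact h2 a (Finset.mem_univ _) b (Finset.mem_univ _) hab (Or.inr ⟨w, hw⟩) hc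


/-- partial embedding -/
def PE {V W : Type*} (A : Finset (Sym2 V)) (H : SimpleGraph W) (f : W → V) (B : Finset W) : Prop :=
  (∀ a ∈ B, ∀ b ∈ B, f a = f b → a = b) ∧ ∀ a ∈ B, ∀ b ∈ B, H.Adj a b → s(f a, f b) ∈ A

/-- embedding state -/
def EmbSt {V W : Type*} (A : Finset (Sym2 V)) (H : SimpleGraph W) (K d : ℕ) (f : W → V) (B : Finset W)
    (Q : Finset (Finset W)) : Prop :=
  PE A H f B ∧ (∀ C ∈ Q, Disjoint C B ∧ C.card ≤ K ∧ ∀ v ∈ C, degIn H C v ≤ 2 ∧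
    2 * degIn H B v + degIn H C v ≤ 2 * d) ∧
  ∀ C ∈ Q, ∀ C' ∈ Q, C ≠ C' → ∀ a ∈ C, ∀ b ∈ C', sepV H a b

lemma exists_idx {W : Type*} {K : ℕ} (hK : 1 ≤ K) (C : Finset W) (hC : C.card ≤ K) :
    ∃ idx : W → Fin K, ∀ a ∈ C, ∀ b ∈ C, idx a = idx b → a = b := by
  refine ⟨fun v => if h : v ∈ C then Fin.castLE hC (C.equivFin ⟨v, h⟩) else ⟨0, hK⟩, ?_⟩
  intro a ha b hb h
  simp only [ha, hb, dif_pos] at h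
  have h1 := Fin.castLE_injective hC h
  have h2 := C.equivFin.injective h1
  exact congrArg Subtype.val h2

/-- neighbourhood part of a template -/
noncomputable def tN {V W : Type*} {K : ℕ} (H : SimpleGraph W) (f : W → V) (B C : Finset W)
    (idx : W → Fin K) (i : Fin K) : Finset V :=
  (B.filter fun w => ∃ v ∈ C, idx v = i ∧ H.Adj v w).image f

/-- inner graph of a template -/
def tI {W : Type*} {K : ℕ} (H : SimpleGraph W) (C : Finset W)
    (idx : W → Fin K) (hidx : ∀ a ∈ C, ∀ b ∈ C, idx a = idx b → a = b) : SimpleGraph (Fin K) where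
  Adj i j := ∃ v ∈ C, ∃ w ∈ C, idx v = i ∧ idx w = j ∧ H.Adj v w
  symm := ⟨fun _ _ ⟨v, hv, w, hw, h1, h2, h3⟩ => ⟨w, hw, v, hv, h2, h1, h3.symm⟩⟩
  loopless := ⟨fun _ ⟨v, hv, w, hw, h1, h2, h3⟩ => h3.ne (hidx v hv w hw (h1.trans h2.symm))⟩

lemma t_bounds {V W : Type*} {K : ℕ} (H : SimpleGraph W) (f : W → V) (B C : Finset W)
    (idx : W → Fin K) (hidx : ∀ a ∈ C, ∀ b ∈ C, idx a = idx b → a = b) (i : Fin K) :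
    (((tN H f B C idx i).card = 0) ∧ dg (tI H C idx hidx) i = 0) ∨
    ∃ v ∈ C, idx v = i ∧ (tN H f B C idx i).card ≤ degIn H B v ∧ dg (tI H C idx hidx) i ≤ degIn H C v := by
  by_cases h : ∃ v ∈ C, idx v = i
  · right
    obtain ⟨v, hv, hvi⟩ := h
    refine ⟨v, hv, hvi, ?_, ?_⟩
    · unfold tN degIn
      refine Finset.card_image_le.trans (Finset.card_le_card ?_)
      intro w hw
      rw [Finset.mem_filter] at hw ⊢
      obtain ⟨hwB, v', hv', h1, h2⟩ := hw
      have := hidx v' hv' v hv (h1.trans hvi.symm)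
      subst this
      exact ⟨hwB, h2⟩
    · unfold dg degIn
      refine (Finset.card_le_card (t := (C.filter fun w => H.Adj v w).image idx) ?_).trans Finset.card_image_le
      intro j hj
      rw [Finset.mem_filter] at hj
      obtain ⟨-, v', hv', w, hw, h1, h2, h3⟩ := hj
      have := hidx v' hv' v hv (h1.trans hvi.symm)
      subst this
      exact Finset.mem_image.2 ⟨w, Finset.mem_filter.2 ⟨hw, h3⟩, h2⟩
  · left
    push Not at h
    constructor
    · unfold tN
      rw [Finset.card_eq_zero, Finset.image_eq_empty, Finset.filter_eq_empty_iff]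
      rintro w - ⟨v, hv, hvi, -⟩
      exact h v hv hvi
    · unfold dg
      rw [Finset.card_eq_zero, Finset.filter_eq_empty_iff]
      rintro j - ⟨v, hv, w, hw, hvi, -⟩
      exact h v hv hvi

lemma step_lemma {V W : Type*} [Fintype V] {A : Finset (Sym2 V)} {H : SimpleGraph W} {K u M d : ℕ}
    (hK : 1 ≤ K) {R : Finset V} (hstar : StarP A R K u M d) {f : W → V} {B : Finset W}
    {Q : Finset (Finset W)} (hST : EmbSt A H K d f B Q) (hQ : 1 ≤ Q.card) (hQV : Q.card ≤ Fintype.card V)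
    (hX : (R ∩ B.image f).card ≤ M * Q.card) (hR : K * u ≤ (R \ B.image f).card) :
    ∃ C ∈ Q, ∃ f' : W → V, EmbSt A H K d f' (B ∪ C) (Q.erase C) ∧
      (∀ w ∈ B ∪ C, f' w ∈ B.image f ∪ R) ∧
      (R ∩ (B ∪ C).image f').card ≤ (R ∩ B.image f).card + K := by
  obtain ⟨⟨hinj, hedge⟩, hun, hsep⟩ := hST
  set X := R ∩ B.image f with hXdef
  have hRX : R \ X = R \ B.image f := by
    ext v; simp only [hXdef, Finset.mem_sdiff, Finset.mem_inter]; tauto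
  set T : Fin Q.card → Finset W := fun τ => (Q.equivFin.symm τ).1 with hT
  have hTQ : ∀ τ, T τ ∈ Q := fun τ => (Q.equivFin.symm τ).2
  have hTinj : ∀ τ τ', τ ≠ τ' → T τ ≠ T τ' := by
    intro τ τ' h h'
    exact h (Q.equivFin.symm.injective (Subtype.ext h'))
  have hidx : ∀ τ, ∃ idx : W → Fin K, ∀ a ∈ T τ, ∀ b ∈ T τ, idx a = idx b → a = b :=
    fun τ => exists_idx hK (T τ) (hun _ (hTQ τ)).2.1
  choose idx hidx using hidx
  obtain ⟨τ, x, hxinj, hxR, hxA⟩ := hstar Q.card hQ hQV X hX (by rw [hRX]; exact hR)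
    (fun τ => tN H f B (T τ) (idx τ)) (fun τ => tI H (T τ) (idx τ) (hidx τ))
    (by
      intro τ i
      rw [hRX, Finset.disjoint_left]
      intro v hv hv'
      have : v ∈ B.image f := by
        unfold tN at hv
        exact Finset.image_subset_image (Finset.filter_subset _ _) hv
      exact (Finset.mem_sdiff.1 hv').2 this)
    (by
      intro τ τ' hne i j
      rw [Finset.disjoint_left]
      intro y hy hy'
      unfold tN at hy hy'
      rw [Finset.mem_image] at hy hy'
      obtain ⟨w, hw, rfl⟩ := hy
      obtain ⟨w', hw', he⟩ := hy'
      rw [Finset.mem_filter] at hw hw'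
      have := hinj w' hw'.1 w hw.1 he
      subst this
      obtain ⟨-, v, hv, -, h1⟩ := hw
      obtain ⟨-, v', hv', -, h2⟩ := hw'
      exact (hsep _ (hTQ τ) _ (hTQ τ') (hTinj τ τ' hne) v hv v' hv').2.2 _ ⟨h1, h2⟩)
    (by
      intro τ i
      rcases t_bounds H f B (T τ) (idx τ) (hidx τ) i with h | ⟨v, hv, -, -, h⟩
      · omega
      · exact h.trans ((hun _ (hTQ τ)).2.2 v hv).1)
    (by
      intro τ i
      rcases t_bounds H f B (T τ) (idx τ) (hidx τ) i with h | ⟨v, hv, -, h1, h2⟩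
      · omega
      · have := ((hun _ (hTQ τ)).2.2 v hv).2
        omega)
  set C := T τ with hC
  have hCQ : C ∈ Q := hTQ τ
  have hCB : ∀ w ∈ B, w ∉ C := fun w hw hw' => Finset.disjoint_left.1 (hun C hCQ).1 hw' hw
  set f' : W → V := fun w => if w ∈ C then x (idx τ w) else f w with hf'
  have hfC : ∀ w ∈ C, f' w = x (idx τ w) := fun w hw => by simp [hf', hw]
  have hfB : ∀ w ∈ B, f' w = f w := fun w hw => by simp [hf', hCB w hw]
  have hxR' : ∀ i, x i ∈ R ∧ x i ∉ B.image f := fun i => by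
    have := hxR i
    rw [hRX, Finset.mem_sdiff] at this
    exact this
  have hcross : ∀ a ∈ B, ∀ b ∈ C, f' a ≠ f' b := by
    intro a ha b hb h
    rw [hfB a ha, hfC b hb] at h
    exact (hxR' (idx τ b)).2 (h ▸ Finset.mem_image_of_mem f ha)
  have hcrossE : ∀ a ∈ B, ∀ b ∈ C, H.Adj b a → s(f' b, f' a) ∈ A := by
    intro a ha b hb h
    apply hxA
    rw [mem_tEdges]
    left
    refine ⟨idx τ b, f a, ?_, by rw [hfB a ha, hfC b hb]⟩
    exact Finset.mem_image_of_mem f (Finset.mem_filter.2 ⟨ha, b, hb, rfl, h⟩)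
  refine ⟨C, hCQ, f', ⟨⟨?_, ?_⟩, ?_, ?_⟩, ?_, ?_⟩
  · intro a ha b hb h
    rcases Finset.mem_union.1 ha with ha | ha <;> rcases Finset.mem_union.1 hb with hb | hb
    · rw [hfB a ha, hfB b hb] at h; exact hinj a ha b hb h
    · exact absurd h (hcross a ha b hb)
    · exact absurd h.symm (hcross b hb a ha)
    · rw [hfC a ha, hfC b hb] at h
      exact hidx τ a ha b hb (hxinj h)
  · intro a ha b hb h
    rcases Finset.mem_union.1 ha with ha | ha <;> rcases Finset.mem_union.1 hb with hb | hb
    · rw [hfB a ha, hfB b hb]; exact hedge a ha b hb h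
    · rw [Sym2.eq_swap]; exact hcrossE a ha b hb h.symm
    · exact hcrossE b hb a ha h
    · apply hxA
      rw [mem_tEdges]
      right
      exact ⟨idx τ a, idx τ b, ⟨a, ha, b, hb, rfl, rfl, h⟩, by rw [hfC a ha, hfC b hb]⟩
  · intro C' hC'
    rw [Finset.mem_erase] at hC'
    obtain ⟨h1, h2, h3⟩ := hun C' hC'.2
    refine ⟨?_, h2, fun v hv => ⟨(h3 v hv).1, ?_⟩⟩
    · rw [Finset.disjoint_union_right]
      refine ⟨h1, ?_⟩
      rw [Finset.disjoint_left]
      intro a ha ha'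
      exact (hsep C' hC'.2 C hCQ hC'.1 a ha a ha').1 rfl
    · have : degIn H (B ∪ C) v = degIn H B v := by
        unfold degIn
        congr 1
        ext w
        simp only [Finset.mem_filter, Finset.mem_union]
        constructor
        · rintro ⟨h | h, h'⟩
          · exact ⟨h, h'⟩
          · exact absurd h' (hsep C' hC'.2 C hCQ hC'.1 v hv w h).2.1
        · exact fun h => ⟨Or.inl h.1, h.2⟩
      rw [this]
      exact (h3 v hv).2
  · intro C1 h1 C2 h2
    exact hsep C1 (Finset.mem_of_mem_erase h1) C2 (Finset.mem_of_mem_erase h2)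
  · intro w hw
    rcases Finset.mem_union.1 hw with hw | hw
    · rw [hfB w hw]; exact Finset.mem_union_left _ (Finset.mem_image_of_mem f hw)
    · rw [hfC w hw]; exact Finset.mem_union_right _ (hxR' _).1
  · have hsub : R ∩ (B ∪ C).image f' ⊆ X ∪ C.image f' := by
      intro v hv
      rw [Finset.mem_inter, Finset.mem_image] at hv
      obtain ⟨hvR, w, hw, rfl⟩ := hv
      rcases Finset.mem_union.1 hw with hw | hw
      · refine Finset.mem_union_left _ (Finset.mem_inter.2 ⟨hvR, ?_⟩)
        rw [hfB w hw]; exact Finset.mem_image_of_mem f hw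
      · exact Finset.mem_union_right _ (Finset.mem_image_of_mem f' hw)
    refine (Finset.card_le_card hsub).trans ((Finset.card_union_le _ _).trans ?_)
    have h1 := Finset.card_image_le (s := C) (f := f')
    have h2 := (hun C hCQ).2.1
    omega

lemma iter_lemma {V W : Type*} [Fintype V] {A : Finset (Sym2 V)} {H : SimpleGraph W} {K u M d : ℕ}
    (hK : 1 ≤ K) {R : Finset V} (hstar : StarP A R K u M d) {f : W → V} {B : Finset W}
    {Q : Finset (Finset W)} (hST : EmbSt A H K d f B Q) (hQV : Q.card ≤ Fintype.card V) (m : ℕ)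
    (hgo : ∀ (f' : W → V) (B' : Finset W) (t : ℕ), m < t → t ≤ Q.card →
      (R ∩ B'.image f').card ≤ (R ∩ B.image f).card + K * (Q.card - t) →
      (R ∩ B'.image f').card ≤ M * t ∧ K * u ≤ (R \ B'.image f').card) :
    ∃ (f' : W → V) (B' : Finset W) (Q' : Finset (Finset W)), EmbSt A H K d f' B' Q' ∧ Q'.card ≤ m ∧
      Q'.card ≤ Q.card ∧
      B' ∪ Q'.biUnion id = B ∪ Q.biUnion id ∧ ∀ w ∈ B', f' w ∈ B.image f ∪ R := by
  have key : ∀ j, j ≤ Q.card - m → ∃ (f' : W → V) (B' : Finset W) (Q' : Finset (Finset W)),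
      EmbSt A H K d f' B' Q' ∧ Q'.card + j = Q.card ∧
      B' ∪ Q'.biUnion id = B ∪ Q.biUnion id ∧ (∀ w ∈ B', f' w ∈ B.image f ∪ R) ∧
      (R ∩ B'.image f').card ≤ (R ∩ B.image f).card + K * j := by
    intro j
    induction j with
    | zero =>
      intro _
      exact ⟨f, B, Q, hST, rfl, rfl, fun w hw => Finset.mem_union_left _ (Finset.mem_image_of_mem f hw), by simp⟩
    | succ j ih =>
      intro hj
      obtain ⟨f', B', Q', h1, h2, h3, h4, h5⟩ := ih (by omega)
      have ht : Q.card - Q'.card = j := by omega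
      obtain ⟨g1, g2⟩ := hgo f' B' Q'.card (by omega) (by omega) (by rw [ht]; exact h5)
      obtain ⟨C, hC, f'', k1, k2, k3⟩ := step_lemma hK hstar h1 (by omega) (by omega) g1 g2
      refine ⟨f'', B' ∪ C, Q'.erase C, k1, ?_, ?_, ?_, ?_⟩
      · have := Finset.card_erase_add_one hC
        omega
      · rw [← h3, Finset.union_assoc]
        congr 1
        conv_rhs => rw [← Finset.insert_erase hC]
        rw [Finset.biUnion_insert]
        rfl
      · intro w hw
        rcases Finset.mem_union.1 (k2 w hw) with h | h
        · obtain ⟨z, hz, he⟩ := Finset.mem_image.1 h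
          rw [← he]; exact h4 z hz
        · exact Finset.mem_union_right _ h
      · have : K * (j + 1) = K * j + K := by ring
        omega
  obtain ⟨f', B', Q', h1, h2, h3, h4, h5⟩ := key (Q.card - m) le_rfl
  exact ⟨f', B', Q', h1, by omega, by omega, h3, h4⟩

/-- used part of the host -/
noncomputable def Zk {V : Type*} (V0 : Finset V) (Reg : ℕ → Finset V) (k : ℕ) : Finset V :=
  V0 ∪ (Finset.range k).biUnion Reg

lemma Zk_succ {V : Type*} (V0 : Finset V) (Reg : ℕ → Finset V) (k : ℕ) :
    Zk V0 Reg k ∪ Reg k = Zk V0 Reg (k + 1) := by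
  unfold Zk
  rw [Finset.range_add_one, Finset.biUnion_insert, Finset.union_assoc, Finset.union_comm (Reg k)]

theorem class_lemma {V W : Type*} [Fintype V] [Fintype W] {A : Finset (Sym2 V)} {H : SimpleGraph W} {K u M d r o : ℕ}
    (hK : 1 ≤ K) (hKM : K ≤ M) (hur : u < 2 ^ r) (hn : Fintype.card V ≤ M * u)
    {V0 : Finset V} {Reg : ℕ → Finset V} (hV0 : Fintype.card W + K * u ≤ V0.card)
    (hstar0 : StarP A V0 K u M d)
    (hReg : ∀ j, j < r → StarP A (Reg (o + j)) K u M d ∧ 2 * (K * u) ≤ (Reg (o + j)).card ∧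
      Disjoint (Zk V0 Reg (o + j)) (Reg (o + j)))
    {f : W → V} {B : Finset W} {Q : Finset (Finset W)} (hST : EmbSt A H K d f B Q)
    (hQV : Q.card ≤ Fintype.card V) (hfB : ∀ w ∈ B, f w ∈ Zk V0 Reg o) :
    ∃ f' : W → V, PE A H f' (B ∪ Q.biUnion id) ∧
      ∀ w ∈ B ∪ Q.biUnion id, f' w ∈ Zk V0 Reg (o + r) := by
  have himg : ∀ (f' : W → V) (B' : Finset W), (B'.image f').card ≤ Fintype.card W := fun f' B' =>
    Finset.card_image_le.trans (Finset.card_le_univ B')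
  obtain ⟨f1, B1, Q1, h1, h2, h2', h3, h4⟩ := iter_lemma hK hstar0 hST hQV u (by
    intro f' B' t ht _ _
    constructor
    · calc _ ≤ Fintype.card V := Finset.card_le_univ _
        _ ≤ M * u := hn
        _ ≤ M * t := Nat.mul_le_mul_left _ ht.le
    · have := Finset.le_card_sdiff (B'.image f') V0
      have := himg f' B'
      omega)
  have key : ∀ i, i ≤ r → ∃ (f' : W → V) (B' : Finset W) (Q' : Finset (Finset W)),
      EmbSt A H K d f' B' Q' ∧ Q'.card ≤ u / 2 ^ i ∧ Q'.card ≤ Q.card ∧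
      B' ∪ Q'.biUnion id = B ∪ Q.biUnion id ∧ (∀ w ∈ B', f' w ∈ Zk V0 Reg (o + i)) := by
    intro i
    induction i with
    | zero =>
      intro _
      refine ⟨f1, B1, Q1, h1, by simpa using h2, h2', h3, fun w hw => ?_⟩
      rcases Finset.mem_union.1 (h4 w hw) with h | h
      · obtain ⟨z, hz, he⟩ := Finset.mem_image.1 h
        rw [← he]; exact hfB z hz
      · exact Finset.mem_union_left _ h
    | succ i ih =>
      intro hi
      obtain ⟨f2, B2, Q2, g1, g2, g2', g3, g4⟩ := ih (by omega)
      obtain ⟨hs, hc, hdis⟩ := hReg i (by omega)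
      have hfresh : (Reg (o + i) ∩ B2.image f2).card = 0 := by
        rw [Finset.card_eq_zero, ← Finset.disjoint_iff_inter_eq_empty, Finset.disjoint_right]
        intro v hv hv'
        obtain ⟨w, hw, rfl⟩ := Finset.mem_image.1 hv
        exact Finset.disjoint_left.1 hdis (g4 w hw) hv'
      have hQu : Q2.card ≤ u := g2.trans (Nat.div_le_self _ _)
      obtain ⟨f3, B3, Q3, k1, k2, k2', k3, k4⟩ := iter_lemma hK hs g1 (g2'.trans hQV) (Q2.card / 2) (by
        intro f' B' t ht ht' hb
        rw [hfresh, zero_add] at hb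
        have e1 : Q2.card - t ≤ t := by omega
        constructor
        · calc _ ≤ K * (Q2.card - t) := hb
            _ ≤ M * t := Nat.mul_le_mul hKM e1
        · have e2 : K * (Q2.card - t) ≤ K * u := Nat.mul_le_mul_left _ (by omega)
          have e3 := Finset.card_sdiff_add_card_inter (Reg (o + i)) (B'.image f')
          omega)
      refine ⟨f3, B3, Q3, k1, ?_, k2'.trans g2', k3.trans g3, fun w hw => ?_⟩
      · rw [pow_succ, ← Nat.div_div_eq_div_mul]
        exact k2.trans (Nat.div_le_div_right g2)
      · rw [← add_assoc, ← Zk_succ]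
        rcases Finset.mem_union.1 (k4 w hw) with h | h
        · obtain ⟨z, hz, he⟩ := Finset.mem_image.1 h
          rw [← he]; exact Finset.mem_union_left _ (g4 z hz)
        · exact Finset.mem_union_right _ h
  obtain ⟨f', B', Q', g1, g2, g2', g3, g4⟩ := key r le_rfl
  rw [Nat.div_eq_of_lt hur, Nat.le_zero, Finset.card_eq_zero] at g2
  subst g2
  rw [Finset.biUnion_empty, Finset.union_empty] at g3
  subst g3
  exact ⟨f', g1.1, g4⟩


lemma degIn_mono {W : Type*} (H : SimpleGraph W) {B C : Finset W} (h : B ⊆ C) (v : W) :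
    degIn H B v ≤ degIn H C v :=
  Finset.card_le_card (Finset.filter_subset_filter _ h)

lemma degIn_lt_of_missing {W : Type*} [Fintype W] (H : SimpleGraph W) {B : Finset W} {v w : W}
    (h : H.Adj v w) (hw : w ∉ B) : degIn H B v < degIn H univ v := by
  unfold degIn
  refine Finset.card_lt_card ?_
  rw [Finset.ssubset_iff_of_subset (Finset.filter_subset_filter _ (Finset.subset_univ _))]
  exact ⟨w, by simp [h], by simp [hw]⟩

lemma degIn_union_disj {W : Type*} (H : SimpleGraph W) {B C : Finset W} (hd : Disjoint C B) (v : W) :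
    degIn H (B ∪ C) v = degIn H B v + degIn H C v := by
  unfold degIn
  rw [Finset.filter_union, Finset.card_union_of_disjoint]
  exact (hd.symm).mono (Finset.filter_subset _ _) (Finset.filter_subset _ _)

theorem embed_thm {V W : Type*} [Fintype V] [Fintype W] [Nonempty V] {A : Finset (Sym2 V)}
    {H : SimpleGraph W} {Δ r u M L : ℕ} (hΔ : 3 ≤ Δ) (hdeg : ∀ v, degIn H univ v ≤ Δ)
    (hWr : Fintype.card W < 2 ^ r) (hur : u < 2 ^ r) (hKM : 2 * r + 2 ≤ M)
    (hn : Fintype.card V ≤ M * u) {V0 : Finset V} {Reg : ℕ → Finset V}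
    (hL : L = (r + 3) * (Δ + Δ * Δ + 1))
    (hV0 : Fintype.card W + (2 * r + 2) * u ≤ V0.card)
    (h01 : StarP A V0 1 u M (Δ - 1)) (h0K : StarP A V0 (2 * r + 2) u M (Δ - 1))
    (hR1 : ∀ k, k < L * r → StarP A (Reg k) 1 u M (Δ - 1) ∧ 2 * u ≤ (Reg k).card)
    (hRK : ∀ k, L * r ≤ k → k < (L + 1) * r →
      StarP A (Reg k) (2 * r + 2) u M (Δ - 1) ∧ 2 * ((2 * r + 2) * u) ≤ (Reg k).card)
    (hdis : ∀ k, k < (L + 1) * r → Disjoint (Zk V0 Reg k) (Reg k)) :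
    ∃ f : W → V, Function.Injective f ∧ ∀ a b, H.Adj a b → s(f a, f b) ∈ A := by
  obtain ⟨𝒞, hC1, hC2, ρ, hρ, hρ2⟩ := structure_thm H Δ r hΔ hWr
  obtain ⟨col, hcol, hcol2⟩ := exists_col H Δ hdeg
  set q := Δ + Δ * Δ + 1 with hq
  set key : W → ℕ := fun v => (r + 2 - ρ v) * q + col v with hkey
  have hWV : Fintype.card W ≤ Fintype.card V := by
    have := Finset.card_le_univ V0
    omega
  have hkeyL : ∀ v, key v < L := by
    intro v
    have h1 : (r + 2 - ρ v) * q ≤ (r + 2) * q := Nat.mul_le_mul_right _ (by omega)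
    have h2 := hcol v
    have h3 : L = (r + 2) * q + q := by rw [hL]; ring
    simp only [hkey]
    omega
  have hkeylt : ∀ v w, ρ w < ρ v → key v < key w := by
    intro v w h
    have h1 : (r + 2 - ρ v + 1) * q ≤ (r + 2 - ρ w) * q :=
      Nat.mul_le_mul_right _ (by have := hρ v; omega)
    have h2 := hcol v
    have h3 : (r + 2 - ρ v + 1) * q = (r + 2 - ρ v) * q + q := by ring
    simp only [hkey]
    omega
  have hkeyeq : ∀ v w, key v = key w → col v = col w := by
    intro v w h
    have hv := hcol v
    have hw := hcol w
    have h1 : key v % q = col v := by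
      simp only [hkey]
      rw [Nat.add_comm, Nat.add_mul_mod_self_right, Nat.mod_eq_of_lt hv]
    have h2 : key w % q = col w := by
      simp only [hkey]
      rw [Nat.add_comm, Nat.add_mul_mod_self_right, Nat.mod_eq_of_lt hw]
    rw [← h1, ← h2, h]
  set Bc : ℕ → Finset W := fun c => univ.filter fun v => (∀ C ∈ 𝒞, v ∉ C) ∧ key v < c with hBc
  have single : ∀ c, c ≤ L → ∃ f : W → V, PE A H f (Bc c) ∧ ∀ w ∈ Bc c, f w ∈ Zk V0 Reg (c * r) := by
    intro c
    induction c with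
    | zero =>
      intro _
      obtain ⟨v0⟩ := ‹Nonempty V›
      refine ⟨fun _ => v0, ⟨?_, ?_⟩, ?_⟩ <;> simp [hBc]
    | succ c ih =>
      intro hc
      obtain ⟨f, hf1, hf2⟩ := ih (by omega)
      set S := univ.filter fun v : W => (∀ C ∈ 𝒞, v ∉ C) ∧ key v = c with hS
      set Q : Finset (Finset W) := S.image fun v => {v} with hQ
      have hQW : Q.card ≤ Fintype.card W := Finset.card_image_le.trans (Finset.card_le_univ _)
      have hcr : ∀ j, j < r → c * r + j < L * r := by
        intro j hj
        have : (c + 1) * r ≤ L * r := Nat.mul_le_mul_right _ hc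
        have e : (c + 1) * r = c * r + r := by ring
        omega
      have hEmb : EmbSt A H 1 (Δ - 1) f (Bc c) Q := by
        refine ⟨hf1, ?_, ?_⟩
        · intro C hC
          obtain ⟨v, hv, rfl⟩ := Finset.mem_image.1 hC
          rw [hS, Finset.mem_filter] at hv
          refine ⟨?_, by simp, ?_⟩
          · rw [Finset.disjoint_singleton_left]
            simp only [hBc, Finset.mem_filter]
            rintro ⟨-, -, h⟩
            omega
          · intro w hw
            rw [Finset.mem_singleton] at hw
            subst hw
            have h0 : degIn H {w} w = 0 := by
              unfold degIn
              rw [Finset.card_eq_zero, Finset.filter_eq_empty_iff]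
              intro x hx
              rw [Finset.mem_singleton] at hx
              subst hx
              exact H.loopless.irrefl x
            have h1 : degIn H (Bc c) w < Δ := by
              rcases hρ2 w hv.2.1 with h | ⟨z, hz, hz'⟩
              · exact (degIn_mono H (Finset.subset_univ _) w).trans_lt h
              · refine (degIn_lt_of_missing H hz ?_).trans_le (hdeg w)
                simp only [hBc, Finset.mem_filter]
                rintro ⟨-, -, h⟩
                have := hkeylt _ _ hz'
                have := hv.2.2
                omega
            omega
        · intro C hC C' hC' hne a ha b hb
          obtain ⟨v, hv, rfl⟩ := Finset.mem_image.1 hC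
          obtain ⟨w, hw, rfl⟩ := Finset.mem_image.1 hC'
          rw [Finset.mem_singleton] at ha hb
          subst ha hb
          rw [hS, Finset.mem_filter] at hv hw
          refine hcol2 a b (fun h => hne (by rw [h])) (hkeyeq _ _ (hv.2.2.trans hw.2.2.symm))
      have hun : Bc c ∪ Q.biUnion id = Bc (c + 1) := by
        ext v
        simp only [hQ, hS, hBc, Finset.mem_union, Finset.mem_filter, Finset.mem_univ, true_and,
          Finset.mem_biUnion, Finset.mem_image, id]
        constructor
        · rintro (h | ⟨C, ⟨w, hw, rfl⟩, hv⟩)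
          · exact ⟨h.1, by omega⟩
          · rw [Finset.mem_singleton] at hv
            subst hv
            exact ⟨hw.1, by omega⟩
        · rintro ⟨h1, h2⟩
          rcases Nat.lt_succ_iff_lt_or_eq.1 h2 with h | h
          · exact Or.inl ⟨h1, h⟩
          · exact Or.inr ⟨{v}, ⟨v, ⟨h1, h⟩, rfl⟩, by simp⟩
      obtain ⟨f', g1, g2⟩ := class_lemma (K := 1) (r := r) (o := c * r) le_rfl (by omega) hur hn (V0 := V0) (Reg := Reg)
        (by
          have : 1 * u ≤ (2 * r + 2) * u := Nat.mul_le_mul_right _ (by omega)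
          omega) h01
        (fun j hj => ⟨(hR1 _ (hcr j hj)).1, by rw [one_mul]; exact (hR1 _ (hcr j hj)).2,
          hdis _ ((hcr j hj).trans_le (Nat.mul_le_mul_right _ (by omega)))⟩)
        hEmb (hQW.trans hWV) hf2
      rw [hun] at g1 g2
      refine ⟨f', g1, ?_⟩
      have e : (c + 1) * r = c * r + r := by ring
      rw [e]
      exact g2
  obtain ⟨f, hf1, hf2⟩ := single L le_rfl
  have hdisj : ∀ C ∈ 𝒞, Disjoint C (Bc L) := by
    intro C hC
    rw [Finset.disjoint_left]
    intro v hv hv'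
    simp only [hBc, Finset.mem_filter] at hv'
    exact hv'.2.1 C hC hv
  have hQW : 𝒞.card ≤ Fintype.card W := by
    have hne : ∀ C : 𝒞, ∃ v, v ∈ C.1 := fun C => (hC1 C.1 C.2).1
    choose g hg using hne
    have hginj : Function.Injective g := by
      intro C C' h
      by_contra hne
      exact (hC2 C.1 C.2 C'.1 C'.2 (fun h' => hne (Subtype.ext h')) _ (hg C) _ (hg C')).1 h
    have := Fintype.card_le_of_injective g hginj
    simpa using this
  have hEmb : EmbSt A H (2 * r + 2) (Δ - 1) f (Bc L) 𝒞 := by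
    refine ⟨hf1, ?_, hC2⟩
    intro C hC
    refine ⟨hdisj C hC, (hC1 C hC).2.1, fun v hv => ?_⟩
    have h2 := (hC1 C hC).2.2 v hv
    have h3 := degIn_union_disj H (hdisj C hC) v
    have h4 := (degIn_mono H (Finset.subset_univ (Bc L ∪ C)) v).trans (hdeg v)
    omega
  have hLr : ∀ j, j < r → L * r + j < (L + 1) * r := by
    intro j hj
    have e : (L + 1) * r = L * r + r := by ring
    omega
  obtain ⟨f', g1, g2⟩ := class_lemma (K := 2 * r + 2) (r := r) (o := L * r) (by omega) hKM hur hn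
    (V0 := V0) (Reg := Reg) hV0 h0K
    (fun j hj => ⟨(hRK _ (by omega) (hLr j hj)).1, (hRK _ (by omega) (hLr j hj)).2, hdis _ (hLr j hj)⟩)
    hEmb (hQW.trans hWV) hf2
  have hall : ∀ v, v ∈ Bc L ∪ 𝒞.biUnion id := by
    intro v
    by_cases h : ∃ C ∈ 𝒞, v ∈ C
    · obtain ⟨C, hC, hv⟩ := h
      exact Finset.mem_union_right _ (Finset.mem_biUnion.2 ⟨C, hC, hv⟩)
    · push Not at h
      exact Finset.mem_union_left _ (by simp only [hBc, Finset.mem_filter]; exact ⟨Finset.mem_univ _, h, hkeyL v⟩)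
  exact ⟨f', fun a b h => g1.1 a (hall a) b (hall b) h, fun a b h => g1.2 a (hall a) b (hall b) h⟩

lemma degIn_of_maxDeg {W : Type*} [Fintype W] {H : SimpleGraph W} {Δ : ℕ} (h : maxDegLE H Δ) (v : W) :
    degIn H univ v ≤ Δ := by
  refine le_trans (le_of_eq ?_) (h v)
  unfold degIn
  rw [Nat.card_eq_fintype_card, ← Set.toFinset_card]
  congr 1
  ext w
  simp [SimpleGraph.mem_neighborSet]

lemma exists_regions {V : Type*} [Fintype V] (N a b s t : ℕ)
    (h : N + a * s + b * t ≤ Fintype.card V) :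
    ∃ (V0 : Finset V) (Reg : ℕ → Finset V), N ≤ V0.card ∧ (∀ k, k < a → s ≤ (Reg k).card) ∧
      (∀ k, a ≤ k → k < a + b → t ≤ (Reg k).card) ∧
      ∀ k, k < a + b → Disjoint (Zk V0 Reg k) (Reg k) := by
  obtain ⟨T1, -, hT1⟩ := Finset.exists_subset_card_eq (s := (univ : Finset V)) (n := a * s)
    (by rw [Finset.card_univ]; omega)
  have hc := Finset.card_compl T1
  obtain ⟨T2, hT2s, hT2⟩ := Finset.exists_subset_card_eq (s := T1ᶜ) (n := b * t)
    (by omega)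
  obtain ⟨U1, hU1, hU1c, hU1d⟩ := exists_disjoint_subsets s a T1 hT1.ge
  obtain ⟨U2, hU2, hU2c, hU2d⟩ := exists_disjoint_subsets t b T2 hT2.ge
  have hT12 : Disjoint T1 T2 := by
    rw [Finset.disjoint_right]
    intro x hx
    exact Finset.mem_compl.1 (hT2s hx)
  set Reg : ℕ → Finset V := fun k => if h : k < a then U1 ⟨k, h⟩ else
    if h : k - a < b then U2 ⟨k - a, h⟩ else ∅ with hReg
  have hR1 : ∀ k (h : k < a), Reg k = U1 ⟨k, h⟩ := fun k h => by simp [hReg, h]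
  have hR2 : ∀ k (h : a ≤ k) (h' : k - a < b), Reg k = U2 ⟨k - a, h'⟩ := fun k h h' => by
    simp [hReg, not_lt.2 h, h']
  have hsub : ∀ k, k < a + b → Reg k ⊆ T1 ∪ T2 := by
    intro k hk
    by_cases h : k < a
    · rw [hR1 k h]; exact (hU1 _).trans Finset.subset_union_left
    · rw [hR2 k (by omega) (by omega)]; exact (hU2 _).trans Finset.subset_union_right
  refine ⟨(T1 ∪ T2)ᶜ, Reg, ?_, ?_, ?_, ?_⟩
  · rw [Finset.card_compl, Finset.card_union_of_disjoint hT12]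
    omega
  · intro k hk; rw [hR1 k hk, hU1c]
  · intro k hk hk'; rw [hR2 k hk (by omega), hU2c]
  · intro k hk
    unfold Zk
    rw [Finset.disjoint_union_left, Finset.disjoint_biUnion_left]
    refine ⟨?_, ?_⟩
    · rw [Finset.disjoint_left]
      intro x hx hx'
      exact Finset.mem_compl.1 hx (hsub k hk hx')
    · intro j hj
      rw [Finset.mem_range] at hj
      by_cases h : k < a
      · rw [hR1 k h, hR1 j (by omega)]
        exact hU1d _ _ (by simp; omega)
      · rw [hR2 k (by omega) (by omega)]
        by_cases h' : j < a
        · rw [hR1 j h']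
          exact hT12.mono (hU1 _) (hU2 _)
        · rw [hR2 j (by omega) (by omega)]
          exact hU2d _ _ (by simp; omega)

theorem prob_bound {n Δ r u M L N : ℕ} (p : ℝ) (hp0 : 0 < p) (hp1 : p ≤ 1) (hΔ : 3 ≤ Δ)
    (hn1 : 1 ≤ n) (hnr : n < 2 ^ r) (hKM : 2 * r + 2 ≤ M) (hu : 1 ≤ u) (hun : u ≤ n)
    (hn : n ≤ M * u) (hL : L = (r + 3) * (Δ + Δ * Δ + 1))
    (hbud : (N + (2 * r + 2) * u) + (L * r) * (2 * u) + r * (2 * ((2 * r + 2) * u)) ≤ n)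
    (hKL : ((2 * r + 2 : ℕ) : ℝ) ≤ u * p ^ (Δ - 1))
    (hmain : ((M : ℝ) + ((Δ - 1 : ℕ) : ℝ) * ((2 * r + 2 : ℕ) : ℝ) + 3) * Real.log ((n : ℝ) + 1)
      + ((2 * r + 2 : ℕ) : ℝ) * ((2 * r + 2 : ℕ) : ℝ)
      ≤ u * p ^ (Δ - 1) / (12 * ((2 * r + 2 : ℕ) : ℝ) ^ 2 * M)) :
    1 - (((L + 1) * r + 1) * 2 : ℕ) * (n * Real.exp (-(3 * Real.log ((n : ℝ) + 1)))) ≤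
      gnpProb n p (fun G => IsUniversal G N Δ) := by
  have : Nonempty (Fin n) := ⟨⟨0, hn1⟩⟩
  obtain ⟨V0, Reg, hV0, hc1, hc2, hdis⟩ := exists_regions (V := Fin n) (N + (2 * r + 2) * u) (L * r) r
    (2 * u) (2 * ((2 * r + 2) * u)) (by rw [Fintype.card_fin]; exact hbud)
  have hLr : (L + 1) * r = L * r + r := by ring
  rw [gnp_eq, PB_compl]
  set RR : Finset (Finset (Fin n)) := insert V0 ((range ((L + 1) * r)).image Reg) with hRR
  set d := Δ - 1 with hd
  set K := 2 * r + 2 with hK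
  set B := RR ×ˢ ({1, K} : Finset ℕ) with hB
  have hBc : B.card ≤ ((L + 1) * r + 1) * 2 := by
    rw [hB, Finset.card_product]
    refine Nat.mul_le_mul ?_ Finset.card_le_two
    refine (Finset.card_insert_le _ _).trans ?_
    have := Finset.card_image_le (s := range ((L + 1) * r)) (f := Reg)
    rw [Finset.card_range] at this
    omega
  have hlog : 0 ≤ Real.log ((n : ℝ) + 1) := Real.log_nonneg (by linarith [Nat.cast_nonneg (α := ℝ) n])
  have hsf : ∀ b ∈ B, PB p (fun A => ¬ StarP A b.1 b.2 u M d) ≤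
      n * Real.exp (-(3 * Real.log ((n : ℝ) + 1))) := by
    rintro ⟨R, k⟩ hb
    rw [hB, Finset.mem_product] at hb
    have hk : k = 1 ∨ k = K := by simpa using hb.2
    have hk1 : 1 ≤ k := by omega
    have hkK : k ≤ K := by omega
    have hkKr : (k : ℝ) ≤ K := by exact_mod_cast hkK
    have hk1r : (1 : ℝ) ≤ k := by exact_mod_cast hk1
    have hMr : (1 : ℝ) ≤ M := by exact_mod_cast (by omega : 1 ≤ M)
    have := star_fail (V := Fin n) (K := k) (u := u) (M := M) (d := d) p hp0 hp1 (by omega) hk1 hu (by omega)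
      (hkKr.trans hKL) (by rw [Fintype.card_fin]; exact hn) R (by
        rw [Fintype.card_fin]
        refine le_trans ?_ (hmain.trans ?_)
        · gcongr
        · gcongr)
    rwa [Fintype.card_fin] at this
  have hP : PB p (fun A : Finset (Sym2 (Fin n)) => ¬ IsUniversal (SimpleGraph.fromEdgeSet (A : Set (Sym2 (Fin n)))) N Δ) ≤
      (((L + 1) * r + 1) * 2 : ℕ) * (n * Real.exp (-(3 * Real.log ((n : ℝ) + 1)))) := by
    calc _ ≤ PB p (fun A => ∃ b ∈ B, ¬ StarP A b.1 b.2 u M d) := by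
          apply PB_mono hp0.le hp1
          intro A
          contrapose!
          intro hA m hm H hH
          have hmem : ∀ k, k < (L + 1) * r → Reg k ∈ RR := fun k hk =>
            Finset.mem_insert_of_mem (Finset.mem_image_of_mem _ (Finset.mem_range.2 hk))
          have hA1 : ∀ R ∈ RR, StarP A R 1 u M d := fun R hR =>
            hA (R, 1) (Finset.mem_product.2 ⟨hR, by simp⟩)
          have hAK : ∀ R ∈ RR, StarP A R K u M d := fun R hR =>
            hA (R, K) (Finset.mem_product.2 ⟨hR, by simp⟩)
          obtain ⟨f, hf1, hf2⟩ := embed_thm (A := A) (H := H) (V0 := V0) (Reg := Reg) (u := u) (r := r)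
            (M := M) hΔ (degIn_of_maxDeg hH)
            (by rw [Fintype.card_fin]; omega) (by omega) hKM (by rw [Fintype.card_fin]; exact hn) hL
            (by rw [Fintype.card_fin]; exact (Nat.add_le_add_right hm _).trans hV0)
            (hA1 _ (Finset.mem_insert_self _ _)) (hAK _ (Finset.mem_insert_self _ _))
            (fun k hk => ⟨hA1 _ (hmem k (by omega)), hc1 k hk⟩)
            (fun k hk hk' => ⟨hAK _ (hmem k hk'), hc2 k hk (by omega)⟩)
            (fun k hk => hdis k (by omega))
          refine ⟨f, hf1, fun a b hab => ?_⟩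
          rw [SimpleGraph.fromEdgeSet_adj]
          exact ⟨by exact_mod_cast hf2 a b hab, fun h => hab.ne (hf1 h)⟩
      _ ≤ ∑ b ∈ B, PB p (fun A => ¬ StarP A b.1 b.2 u M d) := PB_union hp0.le hp1 B _
      _ ≤ ∑ b ∈ B, n * Real.exp (-(3 * Real.log ((n : ℝ) + 1))) := Finset.sum_le_sum hsf
      _ = B.card * (n * Real.exp (-(3 * Real.log ((n : ℝ) + 1)))) := by rw [Finset.sum_const, nsmul_eq_mul]
      _ ≤ _ := by
        gcongr
  linarith

lemma gnp_le_one {n : ℕ} (p : ℝ) (hp0 : 0 ≤ p) (hp1 : p ≤ 1) (P : SimpleGraph (Fin n) → Prop) :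
    gnpProb n p P ≤ 1 := by
  rw [gnp_eq, PB_compl]
  have := PB_nonneg hp0 hp1 (fun A : Finset (Sym2 (Fin n)) => ¬ P (SimpleGraph.fromEdgeSet (A : Set (Sym2 (Fin n)))))
  linarith


lemma growth_lemma {n d r : ℕ} (hn : 2 ≤ n) (hd : 2 ≤ d) (hr : r = Nat.log 2 n + 1) {p C : ℝ}
    (hp0 : 0 ≤ p) (hC : 1 ≤ C)
    (hy : C * 2 ^ 10 ≤ p * (n : ℝ) ^ ((1 : ℝ) / (d : ℝ)) / (Real.logb 2 n) ^ 5) :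
    0 < p ∧ C * (r : ℝ) ^ 10 ≤ n * p ^ d := by
  set l := Real.logb 2 n with hl
  have hn0 : (0 : ℝ) < n := by exact_mod_cast (by omega : 0 < n)
  have hl1 : 1 ≤ l := by
    rw [hl, Real.le_logb_iff_rpow_le (by norm_num) hn0, Real.rpow_one]
    exact_mod_cast hn
  have hrl : (r : ℝ) ≤ 2 * l := by
    have h1 : ((Nat.log 2 n : ℕ) : ℝ) ≤ l := by
      rw [hl, Real.le_logb_iff_rpow_le (by norm_num) hn0, Real.rpow_natCast]
      exact_mod_cast Nat.pow_log_le_self 2 (by omega)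
    rw [hr]; push_cast; linarith
  set y := p * (n : ℝ) ^ ((1 : ℝ) / (d : ℝ)) / l ^ 5 with hyd
  have hl5 : 0 < l ^ 5 := by positivity
  have hy1 : 1 ≤ y := by nlinarith
  have hpn : p * (n : ℝ) ^ ((1 : ℝ) / (d : ℝ)) = y * l ^ 5 := by
    rw [hyd]; field_simp
  constructor
  · rcases hp0.lt_or_eq with h | h
    · exact h
    · exfalso
      rw [← h] at hpn
      have : 0 < y * l ^ 5 := by positivity
      linarith
  · have h1 : (n : ℝ) * p ^ d = (y * l ^ 5) ^ d := by
      rw [← hpn, mul_pow, ← Real.rpow_natCast ((n : ℝ) ^ ((1 : ℝ) / (d : ℝ))), ← Real.rpow_mul hn0.le]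
      have : (1 : ℝ) / (d : ℝ) * d = 1 := by
        have : (d : ℝ) ≠ 0 := by exact_mod_cast (by omega : d ≠ 0)
        field_simp
      rw [this, Real.rpow_one]; ring
    rw [h1]
    have hl51 : 1 ≤ l ^ 5 := one_le_pow₀ hl1
    calc C * (r : ℝ) ^ 10 ≤ C * (2 * l) ^ 10 := by gcongr
      _ = (C * 2 ^ 10) * l ^ 10 := by ring
      _ ≤ y * l ^ 10 := by gcongr
      _ ≤ y ^ 2 * l ^ 10 := by gcongr; nlinarith
      _ = (y * l ^ 5) ^ 2 := by ring
      _ ≤ (y * l ^ 5) ^ d := pow_le_pow_right₀ (by nlinarith) hd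

set_option maxHeartbeats 1000000 in
lemma asymp (ε : ℝ) (hε : 0 < ε) (Δ : ℕ) (hΔ : 3 ≤ Δ) :
    ∃ Y : ℝ, ∀ n : ℕ, 2 ≤ n → ∀ p : ℝ, 0 ≤ p → p ≤ 1 →
      Y ≤ p * (n : ℝ) ^ ((1 : ℝ) / ((Δ : ℝ) - 1)) / (Real.logb 2 n) ^ 5 →
      1 - 2 / ((n : ℝ) + 1) ≤ gnpProb n p (fun G => IsUniversal G ⌊(1 - ε) * n⌋₊ Δ) := by
  set e := min ε 1 with he
  have he0 : 0 < e := lt_min hε one_pos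
  have he1 : e ≤ 1 := min_le_right _ _
  obtain ⟨d, rfl⟩ : ∃ d, Δ = d + 1 := ⟨Δ - 1, by omega⟩
  set q := (d + 1) + (d + 1) * (d + 1) + 1 with hq
  obtain ⟨c, hc⟩ := exists_nat_ge (20 * q / e)
  have hq1 : (1 : ℝ) ≤ q := by exact_mod_cast (by omega : 1 ≤ q)
  have hce : 20 * (q : ℝ) ≤ e * c := by
    rw [div_le_iff₀ he0] at hc; linarith
  have hc20 : (20 : ℝ) ≤ c := by nlinarith [Nat.cast_nonneg (α := ℝ) c]
  have hc20' : 20 ≤ c := by exact_mod_cast hc20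
  set C : ℝ := 768 * c ^ 2 * (2 * c + 4 * d + 19) with hC
  have hd0 : (0 : ℝ) ≤ d := Nat.cast_nonneg _
  have hCc : 4 * (c : ℝ) * 2 ≤ C := by
    rw [hC]
    have : (0 : ℝ) ≤ c * (c - 20) := by apply mul_nonneg <;> linarith
    nlinarith [mul_nonneg (sq_nonneg (c : ℝ)) hd0, mul_nonneg (sq_nonneg (c : ℝ)) (by linarith : (0 : ℝ) ≤ c)]
  refine ⟨C * 2 ^ 10, ?_⟩
  intro n hn p hp0 hp1 hy
  have hdd : (((d + 1 : ℕ) : ℝ) - 1) = d := by push_cast; ring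
  rw [hdd] at hy
  set r := Nat.log 2 n + 1 with hr
  obtain ⟨hp, hgr⟩ := growth_lemma hn (by omega) hr hp0 (by linarith) hy
  have hr1 : 1 ≤ r := by omega
  have hr1' : (1 : ℝ) ≤ r := by exact_mod_cast hr1
  have hn0 : (0 : ℝ) < n := by exact_mod_cast (by omega : 0 < n)
  have hnr : n < 2 ^ r := Nat.lt_pow_succ_log_self (by norm_num) n
  have hpd1 : p ^ d ≤ 1 := pow_le_one₀ hp0 hp1
  have hcr : c * r ^ 2 ≤ n := by
    have h1 : (c : ℝ) * r ^ 2 ≤ n := by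
      calc (c : ℝ) * r ^ 2 ≤ C * r ^ 10 := by
            gcongr
            · linarith
            · norm_num
        _ ≤ n * p ^ d := hgr
        _ ≤ n * 1 := by gcongr
        _ = n := mul_one _
    exact_mod_cast h1
  have hcr0 : 0 < c * r ^ 2 := by positivity
  set u := n / (c * r ^ 2) with hu
  have hu1 : 1 ≤ u := (Nat.one_le_div_iff hcr0).2 hcr
  have hun : u ≤ n := Nat.div_le_self _ _
  have hucr : u * (c * r ^ 2) ≤ n := Nat.div_mul_le_self _ _
  set M := 2 * c * r ^ 2 with hM
  have hnM : n ≤ M * u := by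
    have h1 : n < (u + 1) * (c * r ^ 2) := by
      rw [mul_comm]; exact Nat.lt_mul_div_succ n hcr0
    have h2 : c * r ^ 2 ≤ u * (c * r ^ 2) := Nat.le_mul_of_pos_left _ hu1
    have h3 : M * u = u * (c * r ^ 2) + u * (c * r ^ 2) := by rw [hM]; ring
    have h4 : (u + 1) * (c * r ^ 2) = u * (c * r ^ 2) + c * r ^ 2 := by ring
    omega
  have hKM : 2 * r + 2 ≤ M := by
    rw [hM]
    nlinarith [Nat.mul_le_mul hc20' (Nat.mul_le_mul hr1 hr1)]
  set L := (r + 3) * q with hL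
  have hu0 : (1 : ℝ) ≤ u := by exact_mod_cast hu1
  have hucr' : (u : ℝ) * (c * r ^ 2) ≤ n := by exact_mod_cast hucr
  have hnM' : (n : ℝ) ≤ 2 * c * r ^ 2 * u := by exact_mod_cast hnM
  have hK4 : ((2 * r + 2 : ℕ) : ℝ) ≤ 4 * r := by push_cast; linarith
  have hN : ((⌊(1 - ε) * n⌋₊ : ℕ) : ℝ) ≤ (1 - e) * n := by
    have h1 : (1 - ε) * n ≤ (1 - e) * n := by
      have : e ≤ ε := min_le_left _ _
      gcongr
    refine (Nat.cast_le.2 (Nat.floor_mono h1)).trans (Nat.floor_le ?_)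
    exact mul_nonneg (by linarith) hn0.le
  have hbud : (⌊(1 - ε) * n⌋₊ + (2 * r + 2) * u) + (L * r) * (2 * u) + r * (2 * ((2 * r + 2) * u)) ≤ n := by
    have h1 : (2 * r + 2) + (L * r) * 2 + r * (2 * (2 * r + 2)) ≤ 20 * q * r ^ 2 := by
      have hr2 : r ≤ r ^ 2 := by nlinarith
      have hq' : 1 ≤ q := by omega
      have e1 : L * r ≤ 4 * q * r ^ 2 := by
        calc L * r = q * ((r + 3) * r) := by rw [hL]; ring
          _ ≤ q * (4 * r ^ 2) := Nat.mul_le_mul_left _ (by nlinarith)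
          _ = _ := by ring
      have e2 : r ^ 2 ≤ q * r ^ 2 := Nat.le_mul_of_pos_left _ hq'
      have e3 : r * (2 * (2 * r + 2)) = 4 * r ^ 2 + 4 * r := by ring
      have e4 : 4 * q * r ^ 2 = 4 * (q * r ^ 2) := by ring
      have e5 : 20 * q * r ^ 2 = 20 * (q * r ^ 2) := by ring
      omega
    have h2 : ((2 * r + 2) * u) + (L * r) * (2 * u) + r * (2 * ((2 * r + 2) * u)) ≤ 20 * q * r ^ 2 * u := by
      calc _ = ((2 * r + 2) + (L * r) * 2 + r * (2 * (2 * r + 2))) * u := by ring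
        _ ≤ _ := Nat.mul_le_mul_right _ h1
    have h3 : ((20 * q * r ^ 2 * u : ℕ) : ℝ) ≤ e * n := by
      push_cast
      calc 20 * (q : ℝ) * r ^ 2 * u ≤ e * c * r ^ 2 * u := by gcongr
        _ = e * (u * (c * r ^ 2)) := by ring
        _ ≤ e * n := by gcongr
    have h4 : ⌊(1 - ε) * n⌋₊ + 20 * q * r ^ 2 * u ≤ n := by
      have : ((⌊(1 - ε) * n⌋₊ + 20 * q * r ^ 2 * u : ℕ) : ℝ) ≤ n := by
        rw [Nat.cast_add]; linarith
      exact_mod_cast this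
    omega
  have hup : 384 * c * (2 * c + 4 * d + 19) * (r : ℝ) ^ 8 ≤ u * p ^ d := by
    have h1 : C * (r : ℝ) ^ 10 ≤ (2 * c * r ^ 2) * (u * p ^ d) := by
      calc _ ≤ n * p ^ d := hgr
        _ ≤ (2 * c * r ^ 2 * u) * p ^ d := by gcongr
        _ = _ := by ring
    have h2 : C * (r : ℝ) ^ 10 = (2 * c * r ^ 2) * (384 * c * (2 * c + 4 * d + 19) * (r : ℝ) ^ 8) := by
      rw [hC]; ring
    rw [h2] at h1
    exact le_of_mul_le_mul_left h1 (by positivity)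
  have hr78 : (r : ℝ) ^ 7 ≤ r ^ 8 := pow_le_pow_right₀ hr1' (by norm_num)
  have hr17 : (r : ℝ) ≤ r ^ 7 := le_self_pow₀ hr1' (by norm_num)
  have hE : (1 : ℝ) ≤ 2 * c + 4 * d + 19 := by linarith
  have hup7 : 384 * c * (2 * c + 4 * d + 19) * (r : ℝ) ^ 7 ≤ u * p ^ d := by
    refine le_trans ?_ hup
    gcongr
  have hlog : Real.log ((n : ℝ) + 1) ≤ r := by
    have h1 : (n : ℝ) + 1 ≤ 2 ^ r := by exact_mod_cast hnr
    calc Real.log ((n : ℝ) + 1) ≤ Real.log (2 ^ r) := Real.log_le_log (by positivity) h1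
      _ = r * Real.log 2 := by rw [Real.log_pow]
      _ ≤ r * 1 := by gcongr; linarith [Real.log_two_lt_d9]
      _ = r := mul_one _
  have hlog0 : 0 ≤ Real.log ((n : ℝ) + 1) := Real.log_nonneg (by linarith)
  have hMr : (M : ℝ) = 2 * c * r ^ 2 := by rw [hM]; push_cast; ring
  have hK0 : (0 : ℝ) < ((2 * r + 2 : ℕ) : ℝ) := by positivity
  have hd1 : d + 1 - 1 = d := rfl
  have main := prob_bound (n := n) (Δ := d + 1) (r := r) (u := u) (M := M) (L := L)
    (N := ⌊(1 - ε) * n⌋₊) p hp hp1 hΔ (by omega) hnr hKM hu1 hun hnM rfl hbud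
    (by
      rw [hd1]
      refine hK4.trans (le_trans ?_ hup7)
      have : (4 : ℝ) ≤ 384 * c * (2 * c + 4 * d + 19) := by
        calc (4 : ℝ) ≤ 384 * 20 * 1 := by norm_num
          _ ≤ _ := by gcongr
      calc 4 * (r : ℝ) ≤ 4 * r ^ 7 := by linarith
        _ ≤ _ := by gcongr)
    (by
      rw [hd1, le_div_iff₀ (by rw [hMr]; positivity)]
      set K : ℝ := ((2 * r + 2 : ℕ) : ℝ)
      have h1 : ((M : ℝ) + d * K + 3) * Real.log ((n : ℝ) + 1) + K * K ≤
          (2 * c + 4 * d + 19) * (r : ℝ) ^ 3 := by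
        have hr2 : (r : ℝ) ≤ r ^ 2 := le_self_pow₀ hr1' (by norm_num)
        have hr12 : (1 : ℝ) ≤ r ^ 2 := one_le_pow₀ hr1'
        have hr23 : (r : ℝ) ^ 2 ≤ r ^ 3 := pow_le_pow_right₀ hr1' (by norm_num)
        calc _ ≤ (2 * c * (r : ℝ) ^ 2 + d * (4 * r) + 3) * r + (4 * r) * (4 * r) := by
              rw [hMr]; gcongr
          _ ≤ (2 * c * (r : ℝ) ^ 2 + d * (4 * r ^ 2) + 3 * r ^ 2) * r + 16 * r ^ 3 := by
              have : (4 * (r : ℝ)) * (4 * r) ≤ 16 * r ^ 3 := by nlinarith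
              have h3 : (2 * c * (r : ℝ) ^ 2 + d * (4 * r) + 3) * r ≤
                (2 * c * (r : ℝ) ^ 2 + d * (4 * r ^ 2) + 3 * r ^ 2) * r := by
                gcongr
                linarith
              linarith
          _ = _ := by ring
      have h2 : 12 * K ^ 2 * M ≤ 384 * c * (r : ℝ) ^ 4 := by
        calc 12 * K ^ 2 * M ≤ 12 * (4 * r) ^ 2 * M := by gcongr
          _ = _ := by rw [hMr]; ring
      calc _ ≤ ((2 * c + 4 * d + 19) * (r : ℝ) ^ 3) * (384 * c * (r : ℝ) ^ 4) := by
            apply mul_le_mul h1 h2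
            · positivity
            · positivity
        _ = 384 * c * (2 * c + 4 * d + 19) * (r : ℝ) ^ 7 := by ring
        _ ≤ _ := hup7)
  refine le_trans ?_ main
  have hcnt : (L + 1) * r + 1 ≤ n := by
    have h1 : (L * r) * (2 * 1) ≤ (L * r) * (2 * u) := by gcongr
    have h2 : 2 * r ≤ L * r := by
      apply Nat.mul_le_mul_right
      rw [hL]; nlinarith
    have h3 : (L + 1) * r = L * r + r := by ring
    omega
  have hcnt' : ((((L + 1) * r + 1) * 2 : ℕ) : ℝ) ≤ n * 2 := by exact_mod_cast Nat.mul_le_mul_right 2 hcnt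
  have hexp : Real.exp (-(3 * Real.log ((n : ℝ) + 1))) = 1 / ((n : ℝ) + 1) ^ 3 := by
    have : 3 * Real.log ((n : ℝ) + 1) = Real.log (((n : ℝ) + 1) ^ 3) := by
      rw [Real.log_pow]; norm_num
    rw [this, Real.exp_neg, Real.exp_log (by positivity), one_div]
  rw [hexp]
  have : ((((L + 1) * r + 1) * 2 : ℕ) : ℝ) * (n * (1 / ((n : ℝ) + 1) ^ 3)) ≤ 2 / ((n : ℝ) + 1) := by
    calc _ ≤ (n * 2 : ℝ) * (n * (1 / ((n : ℝ) + 1) ^ 3)) := by gcongr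
      _ = 2 * n ^ 2 / ((n : ℝ) + 1) ^ 3 := by ring
      _ ≤ 2 * (n + 1) ^ 2 / ((n : ℝ) + 1) ^ 3 := by gcongr; linarith
      _ = 2 / ((n : ℝ) + 1) := by field_simp
  linarith

theorem almost_spanning_universality
    (ε : ℝ) (hε : 0 < ε) (Δ : ℕ) (hΔ : 3 ≤ Δ)
    (p : ℕ → ℝ) (hp : ∀ n, 0 ≤ p n ∧ p n ≤ 1)
    (hgrow : Tendsto
      (fun n : ℕ => p n * (n : ℝ) ^ ((1 : ℝ) / ((Δ : ℝ) - 1)) / (Real.logb 2 n) ^ 5)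
      atTop atTop) :
    Tendsto (fun n : ℕ =>
        gnpProb n (p n) (fun G => IsUniversal G ⌊(1 - ε) * n⌋₊ Δ))
      atTop (nhds 1) := by
  obtain ⟨Y, hY⟩ := asymp ε hε Δ hΔ
  have hlim : Tendsto (fun n : ℕ => 1 - 2 / ((n : ℝ) + 1)) atTop (nhds 1) := by
    have h1 : Tendsto (fun n : ℕ => 2 * (1 / ((n : ℝ) + 1))) atTop (nhds (2 * 0)) :=
      tendsto_one_div_add_atTop_nhds_zero_nat.const_mul 2
    have h2 := h1.const_sub 1
    simpa [div_eq_mul_inv] using h2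
  refine tendsto_of_tendsto_of_tendsto_of_le_of_le' hlim tendsto_const_nhds ?_ ?_
  · filter_upwards [hgrow.eventually_ge_atTop Y, eventually_ge_atTop 2] with n h1 h2
    exact hY n h2 (p n) (hp n).1 (hp n).2 h1
  · exact Eventually.of_forall fun n => gnp_le_one (p n) (hp n).1 (hp n).2 _
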